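/- arXiv:2101.06496 — 2 statements merged into one kernel-verified Lean document; each statement's English description precedes it below -/
import Mathlib

section
/- Let K be a field of positive characteristic p, m < n positive integers, X the m×n generic matrix over S = K[x_{ij}], and 1 ≤ t ≤ m. Then the ring R = S/I_t(X) is F-split: there exists an additive map φ : R → R satisfying φ(a^p · x) = a · φ(x) for all a, x ∈ R and φ(1) = 1 (equivalently, the Frobenius endomorphism of R splits as a map of R-modules). In particular R is F-pure. -/
/-- The ideal of `t × t` minors of the generic `m × n` matrix `X` (with entries
`X i j = MvPolynomial.X (i, j)`), using only rows with 1-based index in `[r1, r2]`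
and columns with 1-based index in `[c1, c2]`. -/
noncomputable def genMinors (K : Type*) [Field K] (m n : ℕ) (t : ℕ) (r1 r2 c1 c2 : ℕ) :
    Ideal (MvPolynomial (Fin m × Fin n) K) :=
  Ideal.span { p | ∃ (r : Fin t → Fin m) (c : Fin t → Fin n),
    StrictMono r ∧ StrictMono c ∧
    (∀ i, r1 ≤ (r i).val + 1 ∧ (r i).val + 1 ≤ r2) ∧
    (∀ j, c1 ≤ (c j).val + 1 ∧ (c j).val + 1 ≤ c2) ∧
    p = Matrix.det (Matrix.of fun i j => MvPolynomial.X (r i, c j)) }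

section FSplitHelpers
open MvPolynomial

/-- `f` has leading monomial `u` (with coefficient one) for the weight `w`. -/
def FSLead {K σ : Type*} [Field K] (w : (σ →₀ ℕ) →+ ℕ) (f : MvPolynomial σ K) (u : σ →₀ ℕ) : Prop :=
  f - monomial u 1 ∈ restrictSupport K {v | w v < w u}

theorem FSLead.monomial {K σ : Type*} [Field K] (w : (σ →₀ ℕ) →+ ℕ) (u : σ →₀ ℕ) :
    FSLead w (MvPolynomial.monomial u (1 : K)) u := by
  simp [FSLead]

theorem FSLead.one {K σ : Type*} [Field K] (w : (σ →₀ ℕ) →+ ℕ) :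
    FSLead w (1 : MvPolynomial σ K) 0 := FSLead.monomial w 0

open scoped Pointwise in
theorem FSLead.mul {K σ : Type*} [Field K] {w : (σ →₀ ℕ) →+ ℕ} {f g : MvPolynomial σ K}
    {u v : σ →₀ ℕ} (hf : FSLead w f u) (hg : FSLead w g v) : FSLead w (f * g) (u + v) := by
  unfold FSLead at *
  have key : f * g - MvPolynomial.monomial (u + v) 1 =
      (f - MvPolynomial.monomial u 1) * (g - MvPolynomial.monomial v 1)
      + MvPolynomial.monomial u 1 * (g - MvPolynomial.monomial v 1)
      + (f - MvPolynomial.monomial u 1) * MvPolynomial.monomial v 1 := by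
    have : MvPolynomial.monomial (u + v) (1 : K)
        = MvPolynomial.monomial u 1 * MvPolynomial.monomial v 1 := by
      simp [MvPolynomial.monomial_mul]
    rw [this]; ring
  rw [key]
  have hmul : ∀ (s t : Set (σ →₀ ℕ)) (a b : MvPolynomial σ K), a ∈ restrictSupport K s →
      b ∈ restrictSupport K t → (∀ x ∈ s, ∀ y ∈ t, w (x + y) < w (u + v)) →
      a * b ∈ restrictSupport K {x | w x < w (u + v)} := by
    intro s t a b ha hb h
    have h1 : a * b ∈ restrictSupport K (s + t) := by
      rw [restrictSupport_add]; exact Submodule.mul_mem_mul ha hb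
    refine restrictSupport_mono _ ?_ h1
    rintro _ ⟨x, hx, y, hy, rfl⟩
    exact h x hx y hy
  have hm : ∀ u : σ →₀ ℕ, MvPolynomial.monomial u (1 : K) ∈ restrictSupport K {u} := by
    intro u; simp
  refine add_mem (add_mem (hmul _ _ _ _ hf hg ?_) (hmul _ _ _ _ (hm u) hg ?_))
    (hmul _ _ _ _ hf (hm v) ?_)
  · intro x hx y hy
    simp only [Set.mem_ofPred_eq, map_add] at *; omega
  · intro x hx y hy
    simp only [Set.mem_ofPred_eq, Set.mem_singleton_iff, map_add] at *; subst hx; omega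
  · intro x hx y hy
    simp only [Set.mem_ofPred_eq, Set.mem_singleton_iff, map_add] at *; subst hy; omega

theorem FSLead.pow {K σ : Type*} [Field K] {w : (σ →₀ ℕ) →+ ℕ} {f : MvPolynomial σ K}
    {u : σ →₀ ℕ} (hf : FSLead w f u) (k : ℕ) : FSLead w (f ^ k) (k • u) := by
  induction k with
  | zero => simpa using FSLead.one w
  | succ k ih => rw [pow_succ, succ_nsmul]; exact ih.mul hf

theorem FSLead.prod {K σ ι : Type*} [Field K] {w : (σ →₀ ℕ) →+ ℕ} (s : Finset ι)
    {f : ι → MvPolynomial σ K} {u : ι → (σ →₀ ℕ)} (hf : ∀ i ∈ s, FSLead w (f i) (u i)) :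
    FSLead w (∏ i ∈ s, f i) (∑ i ∈ s, u i) := by
  classical
  induction s using Finset.induction_on with
  | empty => simpa using FSLead.one w
  | insert a s ha ih =>
    rw [Finset.prod_insert ha, Finset.sum_insert ha]
    exact (hf a (by simp)).mul (ih fun i hi => hf i (by simp [hi]))

/-- The weight `(i, j) ↦ i * j`. -/
noncomputable def fsW (m n : ℕ) : ((Fin m × Fin n) →₀ ℕ) →+ ℕ :=
  Finsupp.weight (fun c : Fin m × Fin n => (c.1 : ℕ) * (c.2 : ℕ))

theorem fs_perm_lt {ι : Type*} [Fintype ι] {m n : ℕ} (r : ι → Fin m) (c : ι → Fin n)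
    (hr : Function.Injective r) (h : ∀ a b, r a < r b → c a < c b) (σ : Equiv.Perm ι) (hσ : σ ≠ 1) :
    ∑ i, ((r (σ i) : ℕ) * (c i : ℕ)) < ∑ i, ((r i : ℕ) * (c i : ℕ)) := by
  let _ : LinearOrder ι := LinearOrder.lift' r hr
  have hlt : ∀ a b : ι, a < b ↔ r a < r b := fun a b => Iff.rfl
  have hr' : StrictMono r := fun a b hab => hab
  have hc' : StrictMono c := fun a b hab => h a b hab
  have hmv : Monovary (fun i => (r i : ℕ)) (fun i => (c i : ℕ)) := by
    intro a b hab
    have : a < b := hc'.lt_iff_lt.1 hab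
    exact (hr' this).le
  rw [hmv.sum_comp_perm_mul_lt_sum_mul_iff]
  intro hcon
  apply hσ
  have hmono : Monotone σ := by
    intro a b hab
    rcases hab.eq_or_lt with rfl | hab
    · exact le_rfl
    · exact hr'.le_iff_le.1 (hcon (i := a) (j := b) (hc' hab))
  have hsm : StrictMono σ := hmono.strictMono_of_injective σ.injective
  have e : hsm.orderIsoOfSurjective σ σ.surjective = OrderIso.refl ι := Subsingleton.elim _ _
  ext x
  exact congrArg (fun f : ι ≃o ι => f x) e

theorem fs_det_lead {K ι : Type*} [Field K] [Fintype ι] [DecidableEq ι] {m n : ℕ}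
    (r : ι → Fin m) (c : ι → Fin n)
    (hr : Function.Injective r) (h : ∀ a b, r a < r b → c a < c b) :
    FSLead (fsW m n) (Matrix.det (Matrix.of fun i j => (X (r i, c j) : MvPolynomial _ K)))
      (∑ i, Finsupp.single (r i, c i) 1) := by
  unfold FSLead
  have hmon : ∀ σ : Equiv.Perm ι, ∏ i, (X (r (σ i), c i) : MvPolynomial (Fin m × Fin n) K)
      = monomial (∑ i, Finsupp.single (r (σ i), c i) 1) 1 := by
    intro σ
    rw [MvPolynomial.monomial_sum_one]; rfl
  have hw : ∀ σ : Equiv.Perm ι, fsW m n (∑ i, Finsupp.single (r (σ i), c i) 1)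
      = ∑ i, ((r (σ i) : ℕ) * (c i : ℕ)) := by
    intro σ
    simp [fsW, map_sum, Finsupp.weight_apply]
  rw [Matrix.det_apply', ← Finset.add_sum_erase _ _ (Finset.mem_univ (1 : Equiv.Perm ι))]
  simp only [Matrix.of_apply, hmon]
  simp only [Equiv.Perm.sign_one, Units.val_one, Int.cast_one, one_mul, Equiv.Perm.coe_one, id,
    add_sub_cancel_left]
  refine sum_mem fun σ hσ => ?_
  have hσ1 : σ ≠ 1 := Finset.ne_of_mem_erase hσ
  have hlow : monomial (∑ i, Finsupp.single (r (σ i), c i) 1) (1 : K) ∈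
      restrictSupport K {v | (fsW m n) v < (fsW m n) (∑ x, Finsupp.single (r x, c x) 1)} := by
    rw [monomial_mem_restrictSupport]
    left
    have h1 := hw 1
    simp only [Equiv.Perm.coe_one, id] at h1
    rw [Set.mem_ofPred_eq, hw, h1]
    exact fs_perm_lt r c hr h σ hσ1
  rcases Int.units_eq_one_or (Equiv.Perm.sign σ) with hs | hs
  · simpa [hs] using hlow
  · simpa [hs] using neg_mem hlow

theorem fs_sup_pow {R : Type*} [CommRing R] (I J : Ideal R) (a b : ℕ) :
    (I ⊔ J) ^ (a + b + 1) ≤ I ^ (a + 1) ⊔ J ^ (b + 1) := by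
  rw [← Ideal.add_eq_sup, ← Ideal.add_eq_sup, add_pow, Ideal.sum_eq_sup]
  apply Finset.sup_le
  intro i hi
  by_cases hn : a + 1 ≤ i
  · exact (Ideal.mul_le_left.trans (Ideal.mul_le_left.trans
      ((Ideal.pow_le_pow_right hn).trans le_sup_left)))
  · refine (Ideal.mul_le_left.trans (Ideal.mul_le_right.trans
      ((Ideal.pow_le_pow_right ?_).trans le_sup_right)))
    lia

theorem fs_pigeon {R ι : Type*} [CommRing R] (s : Finset ι) (e : ι → R) (p : ℕ) :
    (Ideal.span (e '' s)) ^ (s.card * p + 1) ≤ Ideal.span ((fun i => e i ^ (p + 1)) '' s) := by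
  classical
  induction s using Finset.induction_on with
  | empty => simp
  | insert a s ha ih =>
    rw [Finset.coe_insert, Set.image_insert_eq, Set.image_insert_eq, Ideal.span_insert,
      Ideal.span_insert, Finset.card_insert_of_notMem ha]
    have : (s.card + 1) * p + 1 = p + s.card * p + 1 := by ring
    rw [this]
    refine (fs_sup_pow _ _ _ _).trans (sup_le_sup ?_ ih)
    rw [Ideal.span_singleton_pow]

theorem fs_det_mem_pow {R ι κ : Type*} [CommRing R] [Fintype ι] [DecidableEq ι]
    [Fintype κ] [DecidableEq κ] (J : Ideal R) (E : Matrix ι ι R) (hE : ∀ i j, E i j ∈ J)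
    (B : Matrix ι κ R) (C : Matrix κ ι R) :
    (E - B * C).det ∈ J ^ (Fintype.card ι - Fintype.card κ) := by
  rw [← Matrix.det_fromBlocks_one₂₂, Matrix.det_apply']
  refine sum_mem fun σ _ => Ideal.mul_mem_left _ _ ?_
  -- columns on the left whose row is on top
  rw [Fintype.prod_sum_type]
  refine Ideal.mul_mem_right _ _ ?_
  set T : Finset ι := Finset.univ.filter fun i => (σ (Sum.inl i)).isLeft with hT
  have hcard : Fintype.card ι - Fintype.card κ ≤ T.card := by
    have h1 : T.card + (Finset.univ.filter fun i => ¬ (σ (Sum.inl i)).isLeft).card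
        = Fintype.card ι := by
      rw [hT, Finset.card_filter_add_card_filter_not]; rfl
    have h2 : (Finset.univ.filter fun i => ¬ (σ (Sum.inl i)).isLeft).card ≤ Fintype.card κ := by
      have : (Finset.univ.filter fun i => ¬ (σ (Sum.inl i)).isLeft).card
          ≤ (Finset.univ.map (Function.Embedding.inr (α := ι) (β := κ))).card := by
        refine Finset.card_le_card_of_injOn (fun i => σ (Sum.inl i)) ?_ ?_
        · intro i hi
          simp at hi
          cases hh : σ (Sum.inl i) with
          | inl x => simp [hh] at hi
          | inr x => simp [hh]
        · intro a _ b _ hab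
          exact Sum.inl_injective (σ.injective hab)
      simpa using this
    omega
  rw [← Finset.prod_mul_prod_compl T]
  refine Ideal.mul_mem_right _ _ (Ideal.pow_le_pow_right hcard ?_)
  have := Ideal.prod_mem_prod (s := T) (I := fun _ => J)
    (x := fun i => Matrix.fromBlocks E B C 1 (σ (Sum.inl i)) (Sum.inl i)) (by
      intro i hi
      simp [hT] at hi
      cases hh : σ (Sum.inl i) with
      | inl x => simpa using hE _ _
      | inr x => simp [hh] at hi)
  simpa using this

theorem fs_anti {m n : ℕ} (v v' : Fin m × Fin n → ℕ)
    (hrow : ∀ i, ∑ j, v (i, j) = ∑ j, v' (i, j)) (hcol : ∀ j, ∑ i, v (i, j) = ∑ i, v' (i, j))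
    (hanti : ∀ c c', v c ≠ 0 → v c' ≠ 0 → ¬ (c.1 < c'.1 ∧ c.2 < c'.2)) :
    ∑ c, v c * ((c.1 : ℕ) * (c.2 : ℕ)) ≤ ∑ c, v' c * ((c.1 : ℕ) * (c.2 : ℕ)) ∧
    (∑ c, v c * ((c.1 : ℕ) * (c.2 : ℕ)) = ∑ c, v' c * ((c.1 : ℕ) * (c.2 : ℕ)) → v = v') := by
  let P : (Fin m × Fin n → ℕ) → (Fin m × Fin n → ℤ) → ℤ := fun v g => ∑ c, (v c : ℤ) * g c
  let ge : ℕ → ℕ → Fin m × Fin n → ℤ := fun a b c => if a ≤ (c.1 : ℕ) ∧ b ≤ (c.2 : ℕ) then 1 else 0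
  have Padd : ∀ v g h, P v (fun c => g c + h c) = P v g + P v h := by
    intro v g h; simp only [P, mul_add, Finset.sum_add_distrib]
  have Psub : ∀ v g h, P v (fun c => g c - h c) = P v g - P v h := by
    intro v g h; simp only [P, mul_sub, Finset.sum_sub_distrib]
  have Hr : ∀ g : Fin m → ℤ, P v (fun c => g c.1) = P v' (fun c => g c.1) := by
    intro g
    simp only [P, Fintype.sum_prod_type, ← Finset.sum_mul]
    refine Finset.sum_congr rfl fun i _ => ?_
    have := hrow i
    congr 1
    exact_mod_cast this
  have Hc : ∀ g : Fin n → ℤ, P v (fun c => g c.2) = P v' (fun c => g c.2) := by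
    intro g
    simp only [P, Fintype.sum_prod_type_right, ← Finset.sum_mul]
    refine Finset.sum_congr rfl fun i _ => ?_
    have := hcol i
    congr 1
    exact_mod_cast this
  have Hge : ∀ a b, P v (ge a b) ≤ P v' (ge a b) := by
    intro a b
    by_cases hex : ∃ c, v c ≠ 0 ∧ a ≤ (c.1 : ℕ) ∧ b ≤ (c.2 : ℕ)
    · obtain ⟨c0, hc0, ha, hb⟩ := hex
      have hid : ge a b = fun c => ((if a ≤ (c.1 : ℕ) then (1 : ℤ) else 0)
          + ((if b ≤ (c.2 : ℕ) then (1 : ℤ) else 0) - 1))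
          + (if (c.1 : ℕ) < a ∧ (c.2 : ℕ) < b then (1 : ℤ) else 0) := by
        funext c
        simp only [ge]
        split_ifs <;> first | omega | simp
      rw [hid, Padd, Padd, Padd, Padd, Hr (fun i => if a ≤ (i : ℕ) then (1 : ℤ) else 0),
        Hc (fun j => (if b ≤ (j : ℕ) then (1 : ℤ) else 0) - 1)]
      gcongr
      refine (Finset.sum_eq_zero fun c _ => ?_).le.trans
        (Finset.sum_nonneg fun c _ => mul_nonneg (by positivity) (by dsimp only; split_ifs <;> simp))
      by_cases hv : v c = 0
      · simp [hv]
      · have := hanti c c0 hv hc0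
        dsimp only
        rw [if_neg, mul_zero]
        rintro ⟨h1, h2⟩
        exact this ⟨Fin.lt_def.2 (by omega), Fin.lt_def.2 (by omega)⟩
    · push Not at hex
      have h0 : P v (ge a b) = 0 := by
        refine Finset.sum_eq_zero fun c _ => ?_
        by_cases hv : v c = 0
        · simp [hv]
        · have := hex c hv
          have h2 : ¬ (a ≤ (c.1 : ℕ) ∧ b ≤ (c.2 : ℕ)) := by
            rintro ⟨h1, h2⟩; exact absurd h2 (not_le.2 (this h1))
          simp [ge, h2]
      rw [h0]
      refine Finset.sum_nonneg fun c _ => mul_nonneg (by positivity) ?_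
      simp only [ge]; split_ifs <;> simp
  have Hw : ∀ v : Fin m × Fin n → ℕ, ((∑ c, v c * ((c.1 : ℕ) * (c.2 : ℕ)) : ℕ) : ℤ)
      = ∑ x ∈ Finset.range m ×ˢ Finset.range n, P v (ge (x.1 + 1) (x.2 + 1)) := by
    intro v
    simp only [P]
    rw [Finset.sum_comm]
    push_cast
    refine Finset.sum_congr rfl fun c _ => ?_
    rw [← Finset.mul_sum]
    congr 1
    have h1 : ∀ k i : ℕ, i < k →
        ∑ a ∈ Finset.range k, (if a + 1 ≤ i then (1 : ℤ) else 0) = i := by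
      intro k i hik
      rw [Finset.sum_ite, Finset.sum_const_zero, add_zero, Finset.sum_const]
      have : (Finset.range k).filter (fun a => a + 1 ≤ i) = Finset.range i := by
        ext a; simp; omega
      rw [this]; simp
    have h2 : ∀ x : ℕ × ℕ, ge (x.1 + 1) (x.2 + 1) c = (if x.1 + 1 ≤ (c.1 : ℕ) then (1 : ℤ) else 0)
        * (if x.2 + 1 ≤ (c.2 : ℕ) then (1 : ℤ) else 0) := by
      intro x
      simp only [ge]
      split_ifs <;> first | omega | simp
    simp only [h2]
    rw [← Finset.sum_product' (s := Finset.range m) (t := Finset.range n)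
      (f := fun a b => (if a + 1 ≤ (c.1 : ℕ) then (1 : ℤ) else 0)
        * (if b + 1 ≤ (c.2 : ℕ) then (1 : ℤ) else 0)) |>.symm, ← Finset.sum_mul_sum,
      h1 m c.1 c.1.2, h1 n c.2 c.2.2]
  refine ⟨?_, fun heq => ?_⟩
  · zify
    have e1 := Hw v
    have e2 := Hw v'
    push_cast at e1 e2
    rw [e1, e2]
    exact Finset.sum_le_sum fun x _ => Hge _ _
  · have e0 : ∑ x ∈ Finset.range m ×ˢ Finset.range n, P v (ge (x.1 + 1) (x.2 + 1))
        = ∑ x ∈ Finset.range m ×ˢ Finset.range n, P v' (ge (x.1 + 1) (x.2 + 1)) := by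
      rw [← Hw, ← Hw, heq]
    rw [Finset.sum_eq_sum_iff_of_le fun x _ => Hge _ _] at e0
    have hall : ∀ a b, a ≤ m → b ≤ n → P v (ge a b) = P v' (ge a b) := by
      intro a b ha hb
      rcases a with _ | a
      · have : ge 0 b = fun c => if b ≤ (c.2 : ℕ) then (1 : ℤ) else 0 := by
          funext c; simp [ge]
        rw [this]; exact Hc (fun j => if b ≤ (j : ℕ) then (1 : ℤ) else 0)
      rcases b with _ | b
      · have : ge (a + 1) 0 = fun c => if a + 1 ≤ (c.1 : ℕ) then (1 : ℤ) else 0 := by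
          funext c; simp [ge]
        rw [this]; exact Hr (fun j => if a + 1 ≤ (j : ℕ) then (1 : ℤ) else 0)
      exact e0 (a, b) (by simp; omega)
    funext ⟨i, j⟩
    have hpt : ∀ u : Fin m × Fin n → ℕ, (u (i, j) : ℤ) = P u (ge i j) - P u (ge (i + 1) j)
        - P u (ge i (j + 1)) + P u (ge (i + 1) (j + 1)) := by
      intro u
      rw [← Psub, ← Psub, ← Padd]
      simp only [P]
      rw [Finset.sum_eq_single (i, j)]
      · simp [ge]
      · rintro ⟨i', j'⟩ _ hne
        have : ¬ ((i' : ℕ) = i ∧ (j' : ℕ) = j) := by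
          rintro ⟨h1, h2⟩; exact hne (by ext <;> simpa)
        simp only [ge]
        apply mul_eq_zero_of_right
        split_ifs <;> first | omega | simp
      · simp
    have := hpt v
    rw [hall _ _ i.2.le j.2.le, hall _ _ i.2 j.2.le, hall _ _ i.2.le j.2, hall _ _ i.2 j.2,
      ← hpt v'] at this
    exact_mod_cast this

/-- A finite set of positions without chains of length `q + 1` is a union of `q` antichains. -/
theorem fs_levels {m n : ℕ} (q : ℕ) : ∀ (U : Finset (Fin m × Fin n)),
    (¬ ∃ (r : Fin (q + 1) → Fin m) (c : Fin (q + 1) → Fin n), StrictMono r ∧ StrictMono c ∧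
      ∀ i, (r i, c i) ∈ U) →
    ∃ l : Fin m × Fin n → ℕ, (∀ x ∈ U, l x < q) ∧
      ∀ x ∈ U, ∀ y ∈ U, l x = l y → ¬ (x.1 < y.1 ∧ x.2 < y.2) := by
  induction q with
  | zero =>
    intro U h
    have hU : ∀ x, x ∉ U := by
      intro x hx
      exact h ⟨fun _ => x.1, fun _ => x.2, fun a b hab => absurd hab (by omega),
        fun a b hab => absurd hab (by omega),
        fun _ => hx⟩
    exact ⟨fun _ => 0, fun x hx => (hU x hx).elim, fun x hx => (hU x hx).elim⟩
  | succ q ih =>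
    intro U h
    obtain ⟨l, h1, h2⟩ := ih (U.filter fun x => ∃ y ∈ U, y.1 < x.1 ∧ y.2 < x.2) (by
      rintro ⟨r, c, hr, hc, hU⟩
      apply h
      have h0 := hU 0
      simp only [Finset.mem_filter] at h0
      obtain ⟨y, hy, hy1, hy2⟩ := h0.2
      refine ⟨Fin.cons y.1 r, Fin.cons y.2 c, ?_, ?_, ?_⟩
      · exact _root_.strictMono_vecCons.2 ⟨hy1, hr⟩
      · exact _root_.strictMono_vecCons.2 ⟨hy2, hc⟩
      · intro i
        refine Fin.cases ?_ (fun i => ?_) i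
        · simpa using hy
        · have := hU i
          simp only [Finset.mem_filter] at this
          simpa using this.1)
    classical
    refine ⟨fun x => if ∃ y ∈ U, y.1 < x.1 ∧ y.2 < x.2 then l x + 1 else 0, ?_, ?_⟩
    · intro x hx
      dsimp only
      split_ifs with hh
      · have := h1 x (by simp only [Finset.mem_filter]; exact ⟨hx, hh⟩)
        omega
      · omega
    · intro x hx y hy hxy hlt
      have hyy : ∃ z ∈ U, z.1 < y.1 ∧ z.2 < y.2 := ⟨x, hx, hlt⟩
      simp only [hyy, if_true] at hxy
      split_ifs at hxy with hh
      · exact h2 x (by simp only [Finset.mem_filter]; exact ⟨hx, hh⟩) y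
          (by simp only [Finset.mem_filter]; exact ⟨hy, hyy⟩) (by omega) hlt

/-- Monomials containing no chain (main diagonal) of length `t`. -/
def fsN (m n t : ℕ) : Set ((Fin m × Fin n) →₀ ℕ) :=
  {u | ¬ ∃ (r : Fin t → Fin m) (c : Fin t → Fin n), StrictMono r ∧ StrictMono c ∧
      ∀ i, (r i, c i) ∈ u.support}

theorem fs_span {K : Type*} [Field K] {m n t : ℕ} (I : Ideal (MvPolynomial (Fin m × Fin n) K))
    (hI : ∀ (r : Fin t → Fin m) (c : Fin t → Fin n), StrictMono r → StrictMono c →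
      Matrix.det (Matrix.of fun i j => (X (r i, c j) : MvPolynomial _ K)) ∈ I) :
    I.restrictScalars K ⊔ restrictSupport K (fsN m n t) = ⊤ := by
  have key : ∀ (N : ℕ) (u : (Fin m × Fin n) →₀ ℕ), fsW m n u < N →
      monomial u (1 : K) ∈ I.restrictScalars K ⊔ restrictSupport K (fsN m n t) := by
    intro N
    induction N with
    | zero => intro u hu; omega
    | succ N ih =>
      intro u hu
      by_cases hN : u ∈ fsN m n t
      · exact Submodule.mem_sup_right (by simp [hN])
      · have hN' : ∃ (r : Fin t → Fin m) (c : Fin t → Fin n), StrictMono r ∧ StrictMono c ∧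
            ∀ i, (r i, c i) ∈ u.support := not_not.1 hN
        obtain ⟨r, c, hr, hc, hs⟩ := hN'
        set d : (Fin m × Fin n) →₀ ℕ := ∑ i, Finsupp.single (r i, c i) 1 with hd
        have hdu : d ≤ u := by
          intro x
          by_cases hx : ∃ i, (r i, c i) = x
          · obtain ⟨i, rfl⟩ := hx
            have h1 : d (r i, c i) = 1 := by
              rw [hd, Finsupp.finsetSum_apply, Finset.sum_eq_single i]
              · simp
              · intro j _ hj
                rw [Finsupp.single_apply, if_neg]
                intro h; exact hj (hr.injective (Prod.ext_iff.1 h).1)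
              · simp
            have := hs i
            rw [Finsupp.mem_support_iff] at this
            omega
          · have h0 : d x = 0 := by
              rw [hd, Finsupp.finsetSum_apply]
              refine Finset.sum_eq_zero fun j _ => ?_
              rw [Finsupp.single_apply, if_neg]
              intro h; exact hx ⟨j, h⟩
            omega
        have hlead := (FSLead.monomial (K := K) (fsW m n) (u - d)).mul
          (fs_det_lead (K := K) r c hr.injective
            (fun a b hab => hc (hr.lt_iff_lt.1 hab)))
        rw [← hd, tsub_add_cancel_of_le hdu] at hlead
        unfold FSLead at hlead
        set D := monomial (u - d) (1 : K) *
          Matrix.det (Matrix.of fun i j => (X (r i, c j) : MvPolynomial _ K)) with hD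
        have hDI : D ∈ I := I.mul_mem_left _ (hI r c hr hc)
        have h2 : D - monomial u 1 ∈ I.restrictScalars K ⊔ restrictSupport K (fsN m n t) := by
          rw [restrictSupport_eq_span] at hlead
          refine (Submodule.span_le.2 ?_) hlead
          rintro _ ⟨v, hv, rfl⟩
          exact ih v (lt_of_lt_of_le hv (by omega))
        have h3 : D ∈ I.restrictScalars K ⊔ restrictSupport K (fsN m n t) :=
          Submodule.mem_sup_left hDI
        have := sub_mem h3 h2
        simpa using this
  rw [eq_top_iff]
  intro g _
  rw [g.as_sum]
  refine sum_mem fun u _ => ?_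
  have : monomial u (coeff u g) = coeff u g • monomial u (1 : K) := by
    rw [smul_monomial, smul_eq_mul, mul_one]
  rw [this]
  exact Submodule.smul_mem _ _ (key _ u (Nat.lt_succ_self _))

/-- The substitution `x_c ↦ ∑_k w_{k,c}`. -/
noncomputable def fsA (K : Type*) [Field K] (m n q : ℕ) :
    MvPolynomial (Fin m × Fin n) K →ₐ[K] MvPolynomial (Fin q × Fin m × Fin n) K :=
  aeval fun c => ∑ k, X (k, c)

/-- The monomial substitution `w_{k,i,j} ↦ y_{i,k} z_{k,j}`. -/
noncomputable def fsB (K : Type*) [Field K] (m n q : ℕ) :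
    MvPolynomial (Fin q × Fin m × Fin n) K →ₐ[K]
      MvPolynomial ((Fin m × Fin q) ⊕ (Fin q × Fin n)) K :=
  aeval fun x => X (Sum.inl (x.2.1, x.1)) * X (Sum.inr (x.1, x.2.2))

/-- The exponent map of `fsB`. -/
noncomputable def fsBe (m n q : ℕ) :
    ((Fin q × Fin m × Fin n) →₀ ℕ) →+ (((Fin m × Fin q) ⊕ (Fin q × Fin n)) →₀ ℕ) :=
  Finsupp.weight fun x => Finsupp.single (Sum.inl (x.2.1, x.1)) 1
    + Finsupp.single (Sum.inr (x.1, x.2.2)) 1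

theorem fsB_monomial (K : Type*) [Field K] (m n q : ℕ) (v : (Fin q × Fin m × Fin n) →₀ ℕ) (a : K) :
    fsB K m n q (monomial v a) = monomial (fsBe m n q v) a := by
  rw [fsB, aeval_monomial, fsBe, Finsupp.weight_apply, ← mul_one a, ← C_mul_monomial,
    Finsupp.sum, monomial_sum_one, Finsupp.prod]
  congr 1
  · simp [MvPolynomial.algebraMap_eq]
  · refine Finset.prod_congr rfl fun x _ => ?_
    rw [← one_pow (M := K) (v x), ← monomial_pow, ← mul_one (1 : K), ← monomial_mul]
    simp [X]

theorem fsBe_inl (m n q : ℕ) (v : (Fin q × Fin m × Fin n) →₀ ℕ) (i : Fin m) (k : Fin q) :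
    fsBe m n q v (Sum.inl (i, k)) = ∑ j, v (k, i, j) := by
  rw [fsBe, Finsupp.weight_apply, Finsupp.sum_fintype _ _ (by simp), Finsupp.finsetSum_apply]
  simp only [Fintype.sum_prod_type, Finsupp.smul_apply, Finsupp.add_apply, Finsupp.single_apply,
    Sum.inl.injEq, Prod.mk.injEq, reduceCtorEq, if_false, add_zero, smul_eq_mul]
  rw [Finset.sum_eq_single k, Finset.sum_eq_single i]
  · simp
  · intro b _ hb; simp [hb]
  · simp
  · intro b _ hb; simp [hb]
  · simp

theorem fsBe_inr (m n q : ℕ) (v : (Fin q × Fin m × Fin n) →₀ ℕ) (j : Fin n) (k : Fin q) :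
    fsBe m n q v (Sum.inr (k, j)) = ∑ i, v (k, i, j) := by
  rw [fsBe, Finsupp.weight_apply, Finsupp.sum_fintype _ _ (by simp), Finsupp.finsetSum_apply]
  simp only [Fintype.sum_prod_type, Finsupp.smul_apply, Finsupp.add_apply, Finsupp.single_apply,
    Sum.inr.injEq, Prod.mk.injEq, reduceCtorEq, if_false, zero_add, smul_eq_mul]
  rw [Finset.sum_eq_single k]
  · refine Finset.sum_congr rfl fun i _ => ?_
    rw [Finset.sum_eq_single j]
    · simp
    · intro b _ hb; simp [hb]
    · simp
  · intro b _ hb; simp [hb]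
  · simp

/-- Exponents: forget the level `k`. -/
noncomputable def fsPi (m n q : ℕ) : ((Fin q × Fin m × Fin n) →₀ ℕ) →+ ((Fin m × Fin n) →₀ ℕ) :=
  Finsupp.weight fun x => Finsupp.single x.2 1

theorem fsPi_apply (m n q : ℕ) (v : (Fin q × Fin m × Fin n) →₀ ℕ) (c : Fin m × Fin n) :
    fsPi m n q v c = ∑ k, v (k, c) := by
  rw [fsPi, Finsupp.weight_apply, Finsupp.sum_fintype _ _ (by simp), Finsupp.finsetSum_apply,
    Fintype.sum_prod_type]
  refine Finset.sum_congr rfl fun k _ => ?_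
  rw [Finset.sum_eq_single c]
  · simp
  · intro b _ hb; simp [Finsupp.single_apply, hb]
  · simp

theorem fsA_support (K : Type*) [Field K] (m n q : ℕ) (u : (Fin m × Fin n) →₀ ℕ) (a : K)
    (v : (Fin q × Fin m × Fin n) →₀ ℕ) (hv : coeff v (fsA K m n q (monomial u a)) ≠ 0) :
    fsPi m n q v = u := by
  have h : IsWeightedHomogeneous (fun x : Fin q × Fin m × Fin n => Finsupp.single x.2 1)
      (fsA K m n q (monomial u a)) u := by
    rw [fsA, aeval_monomial, MvPolynomial.algebraMap_eq]
    have h2 : IsWeightedHomogeneous (fun x : Fin q × Fin m × Fin n => Finsupp.single x.2 1)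
      (u.prod fun c k => (∑ j : Fin q, X (j, c) : MvPolynomial (Fin q × Fin m × Fin n) K) ^ k)
      (∑ c ∈ u.support, u c • Finsupp.single c 1) := by
      refine IsWeightedHomogeneous.prod _ _ _ fun c _ => IsWeightedHomogeneous.pow ?_ _
      refine IsWeightedHomogeneous.sum _ _ _ fun j _ => ?_
      exact isWeightedHomogeneous_X K _ (j, c)
    have h3 : ∑ c ∈ u.support, u c • Finsupp.single c 1 = u := by
      conv_rhs => rw [← Finsupp.sum_single u]
      simp [Finsupp.sum]
    rw [h3] at h2
    exact h2.C_mul a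
  exact h hv

/-- `fsA` of a monomial, coefficient of the term where `x_c` is sent to `w_{l c, c}`. -/
theorem fsA_coeff (K : Type*) [Field K] (m n q : ℕ) (u : (Fin m × Fin n) →₀ ℕ)
    (l : Fin m × Fin n → ℕ) (hl : ∀ c ∈ u.support, l c < q)
    (v : (Fin q × Fin m × Fin n) →₀ ℕ) (hv : ∀ k c, v (k, c) = if l c = k then u c else 0) :
    coeff v (fsA K m n q (monomial u 1)) = 1 := by
  let w : ((Fin q × Fin m × Fin n) →₀ ℕ) →+ ℕ :=
    Finsupp.weight fun x => if l x.2 = (x.1 : ℕ) then 1 else 0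
  let e : Fin m × Fin n → ((Fin q × Fin m × Fin n) →₀ ℕ) := fun c =>
    if h : l c < q then Finsupp.single (⟨l c, h⟩, c) 1 else 0
  have h1 : FSLead w (u.prod fun c k =>
      (∑ j : Fin q, X (j, c) : MvPolynomial (Fin q × Fin m × Fin n) K) ^ k)
      (∑ c ∈ u.support, u c • e c) := by
    refine FSLead.prod _ fun c hc => FSLead.pow ?_ _
    have hlc := hl c hc
    simp only [e, hlc, dif_pos]
    unfold FSLead
    rw [← Finset.add_sum_erase _ _ (Finset.mem_univ (⟨l c, hlc⟩ : Fin q))]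
    have : (X (⟨l c, hlc⟩, c) : MvPolynomial (Fin q × Fin m × Fin n) K)
      = monomial (Finsupp.single (⟨l c, hlc⟩, c) 1) 1 := rfl
    rw [this, add_sub_cancel_left]
    refine sum_mem fun k hk => ?_
    have hk' : l c ≠ (k : ℕ) := by
      intro h; exact Finset.ne_of_mem_erase hk (Fin.ext h.symm)
    rw [X, monomial_mem_restrictSupport]
    left
    simp [w, Finsupp.weight_apply, hk']
  have h2 : ∑ c ∈ u.support, u c • e c = v := by
    ext ⟨k, c⟩
    rw [hv, Finsupp.finsetSum_apply]
    by_cases hc : c ∈ u.support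
    · rw [Finset.sum_eq_single c]
      · have hlc := hl c hc
        simp [e, hlc, Finsupp.single_apply, Fin.ext_iff]
      · intro b hb hbc
        have hlb := hl b hb
        simp [e, hlb, Finsupp.single_apply, hbc]
      · intro h; exact absurd hc h
    · have : u c = 0 := by simpa using hc
      rw [this, ite_self]
      refine Finset.sum_eq_zero fun b hb => ?_
      have hlb := hl b hb
      have hbc : b ≠ c := by rintro rfl; exact hc hb
      simp [e, hlb, Finsupp.single_apply, hbc]
  rw [fsA, aeval_monomial, map_one, one_mul]
  rw [h2] at h1
  unfold FSLead at h1
  have h3 : coeff v ((u.prod fun c k =>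
      (∑ j : Fin q, X (j, c) : MvPolynomial (Fin q × Fin m × Fin n) K) ^ k) - monomial v 1) = 0 := by
    by_contra hne
    have := h1 (show v ∈ _ from MvPolynomial.mem_support_iff.2 hne)
    simp at this
  rw [coeff_sub, coeff_monomial, if_pos rfl, sub_eq_zero] at h3
  exact h3

theorem fsW_apply (m n : ℕ) (u : (Fin m × Fin n) →₀ ℕ) :
    fsW m n u = ∑ c, u c * ((c.1 : ℕ) * (c.2 : ℕ)) := by
  rw [fsW, Finsupp.weight_apply, Finsupp.sum_fintype _ _ (by simp)]
  simp

theorem fsW_pi (m n q : ℕ) (v : (Fin q × Fin m × Fin n) →₀ ℕ) :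
    fsW m n (fsPi m n q v) = ∑ k, ∑ c : Fin m × Fin n, v (k, c) * ((c.1 : ℕ) * (c.2 : ℕ)) := by
  rw [fsW_apply, Finset.sum_comm]
  refine Finset.sum_congr rfl fun c _ => ?_
  rw [fsPi_apply, Finset.sum_mul]

theorem fs_indep (K : Type*) [Field K] (m n q : ℕ) (g : MvPolynomial (Fin m × Fin n) K)
    (hg : g ∈ restrictSupport K (fsN m n (q + 1))) (h0 : fsB K m n q (fsA K m n q g) = 0) :
    g = 0 := by
  by_contra hne
  obtain ⟨u0, hu0, hmax⟩ := Finset.exists_max_image g.support (fsW m n)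
    (by rwa [Finset.nonempty_iff_ne_empty, Ne, MvPolynomial.support_eq_empty])
  have hN : u0 ∈ fsN m n (q + 1) := hg hu0
  obtain ⟨l, hl, hla⟩ := fs_levels q u0.support hN
  let v0 : (Fin q × Fin m × Fin n) →₀ ℕ :=
    Finsupp.equivFunOnFinite.symm fun x => if l x.2 = (x.1 : ℕ) then u0 x.2 else 0
  have hv0 : ∀ k c, v0 (k, c) = if l c = (k : ℕ) then u0 c else 0 := fun k c => rfl
  have hone := fsA_coeff K m n q u0 l hl v0 hv0
  have hpi0 : fsPi m n q v0 = u0 := fsA_support K m n q u0 1 v0 (by rw [hone]; exact one_ne_zero)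
  have hexp : ∀ v, coeff v (fsA K m n q g)
      = ∑ u ∈ g.support, coeff v (fsA K m n q (monomial u (coeff u g))) := by
    intro v
    conv_lhs => rw [g.as_sum]
    rw [map_sum, coeff_sum]
  have claim1 : ∀ v, coeff v (fsA K m n q g) ≠ 0 → fsBe m n q v = fsBe m n q v0 → v = v0 := by
    intro v hv hB
    rw [hexp] at hv
    obtain ⟨u, hu, huv⟩ := Finset.exists_ne_zero_of_sum_ne_zero hv
    have hpi := fsA_support K m n q u _ v huv
    have hle := hmax u hu
    rw [← hpi, ← hpi0, fsW_pi, fsW_pi] at hle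
    have hk : ∀ k, _ := fun k => fs_anti (fun c => v0 (k, c)) (fun c => v (k, c))
      (fun i => by rw [← fsBe_inl, ← fsBe_inl, hB]) (fun j => by rw [← fsBe_inr, ← fsBe_inr, hB])
      (by
        intro c c' hc hc'
        simp only [hv0, ne_eq, ite_eq_right_iff, Classical.not_imp] at hc hc'
        exact hla c (by simpa using hc.2) c' (by simpa using hc'.2) (hc.1.trans hc'.1.symm))
    have heq := le_antisymm (Finset.sum_le_sum fun k _ => (hk k).1) hle
    rw [Finset.sum_eq_sum_iff_of_le fun k _ => (hk k).1] at heq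
    ext ⟨k, c⟩
    exact (congrFun ((hk k).2 (heq k (Finset.mem_univ k))) c).symm
  have claim2 : coeff v0 (fsA K m n q g) = coeff u0 g := by
    rw [hexp, Finset.sum_eq_single u0]
    · have : monomial u0 (coeff u0 g) = C (coeff u0 g) * monomial u0 1 := by
        rw [C_mul_monomial, mul_one]
      rw [this, map_mul, ← MvPolynomial.algebraMap_eq, AlgHom.commutes, MvPolynomial.algebraMap_eq,
        coeff_C_mul, hone, mul_one]
    · intro u _ hne
      by_contra hc
      exact hne ((fsA_support K m n q u _ v0 hc).symm.trans hpi0)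
    · intro h; exact absurd hu0 h
  have hfin : coeff (fsBe m n q v0) (fsB K m n q (fsA K m n q g)) = coeff u0 g := by
    conv_lhs => rw [(fsA K m n q g).as_sum]
    rw [map_sum, coeff_sum]
    simp only [fsB_monomial, coeff_monomial]
    rw [Finset.sum_eq_single v0]
    · rw [if_pos rfl, claim2]
    · intro v hv hne
      rw [if_neg]
      intro hB
      exact hne (claim1 v (MvPolynomial.mem_support_iff.1 hv) hB)
    · intro h
      rw [if_pos rfl]
      simpa using h
  rw [h0, coeff_zero] at hfin
  exact MvPolynomial.mem_support_iff.1 hu0 hfin.symm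

/-- The kernel of the map to `K[Y, Z]`, `X ↦ Y Z`, lies in any ideal containing the minors
(and, conversely, contained in the kernel). -/
theorem fs_ker_le (K : Type*) [Field K] (m n q : ℕ) (I : Ideal (MvPolynomial (Fin m × Fin n) K))
    (hI : ∀ (r : Fin (q + 1) → Fin m) (c : Fin (q + 1) → Fin n), StrictMono r → StrictMono c →
      Matrix.det (Matrix.of fun i j => (X (r i, c j) : MvPolynomial _ K)) ∈ I)
    (hle : ∀ a ∈ I, fsB K m n q (fsA K m n q a) = 0)
    (g : MvPolynomial (Fin m × Fin n) K) (hg : fsB K m n q (fsA K m n q g) = 0) : g ∈ I := by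
  have hs := fs_span I hI
  have : g ∈ I.restrictScalars K ⊔ restrictSupport K (fsN m n (q + 1)) := by
    rw [hs]; trivial
  obtain ⟨a, ha, b, hb, rfl⟩ := Submodule.mem_sup.1 this
  have ha' : a ∈ I := ha
  rw [map_add, map_add, hle a ha', zero_add] at hg
  rw [fs_indep K m n q b hb hg, add_zero]
  exact ha'

/-- A splitting of the Frobenius of a field. -/
theorem fs_field (K : Type*) [Field K] (p : ℕ) [Fact p.Prime] [CharP K p] :
    ∃ s : K →+ K, (∀ a x, s (a ^ p * x) = a * s x) ∧ s 1 = 1 := by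
  let F := (frobenius K p).fieldRange
  obtain ⟨l, hl⟩ := LinearMap.exists_leftInverse_of_injective (Algebra.linearMap F K)
    (LinearMap.ker_eq_bot.2 (algebraMap F K).injective)
  let e : K ≃+* F := RingEquiv.ofBijective (frobenius K p).rangeRestrictField
    ⟨(frobenius K p).rangeRestrictField.injective, by rintro ⟨_, x, rfl⟩; exact ⟨x, rfl⟩⟩
  refine ⟨(e.symm : F →+* K).toAddMonoidHom.comp l.toAddMonoidHom, ?_, ?_⟩
  · intro a x
    have h1 : l (a ^ p * x) = e a * l x := by
      have : a ^ p * x = e a • x := by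
        rw [Algebra.smul_def]; rfl
      rw [this, map_smul, smul_eq_mul]
    change e.symm (l (a ^ p * x)) = a * e.symm (l x)
    rw [h1, map_mul, RingEquiv.symm_apply_apply]
  · have : l 1 = 1 := by
      have := LinearMap.congr_fun hl 1
      simpa using this
    change e.symm (l 1) = 1
    rw [this, map_one]

/-- The trace-like generator of `Hom(F_* S, S)`. -/
theorem fs_trace (K σ : Type*) [Field K] [Finite σ] (p : ℕ) [hp : Fact p.Prime] [CharP K p] :
    ∃ T : MvPolynomial σ K →+ MvPolynomial σ K, (∀ a x, T (a ^ p * x) = a * T x) ∧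
      (∀ u c, (∃ i, u i < p - 1) → T (monomial u c) = 0) ∧
      ∀ u : σ →₀ ℕ, (∀ i, u i = p - 1) → T (monomial u 1) = 1 := by
  classical
  obtain ⟨s, hs, hs1⟩ := fs_field K p
  have hp0 : 0 < p := hp.out.pos
  let d : (σ →₀ ℕ) → (σ →₀ ℕ) := fun u => u.mapRange (fun k => k / p) (by simp)
  let t : (σ →₀ ℕ) → K →+ MvPolynomial σ K := fun u =>
    if ∀ i, u i % p = p - 1 then (monomial (d u)).toAddMonoidHom.comp s else 0
  let T0 : ((σ →₀ ℕ) →₀ K) →+ MvPolynomial σ K := Finsupp.liftAddHom t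
  let T : MvPolynomial σ K →+ MvPolynomial σ K :=
    T0.comp (AddMonoidAlgebra.coeffAddEquiv : MvPolynomial σ K ≃+ ((σ →₀ ℕ) →₀ K)).toAddMonoidHom
  have hT : ∀ u c, T (monomial u c) = t u c := by
    intro u c
    change T0 (Finsupp.single u c) = _
    simp [T0]
  refine ⟨T, ?_, ?_, ?_⟩
  · have hmm : ∀ u a v c, T (monomial u a ^ p * monomial v c) = monomial u a * T (monomial v c) := by
      intro u a v c
      rw [monomial_pow, monomial_mul, hT, hT]
      have hcond : (∀ i, (p • u + v) i % p = p - 1) ↔ ∀ i, v i % p = p - 1 := by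
        refine forall_congr' fun i => ?_
        simp
      simp only [t, hcond]
      split_ifs with h
      · have : d (p • u + v) = u + d v := by
          ext i
          simp [d, Nat.mul_add_div hp0]
        simp only [AddMonoidHom.comp_apply, LinearMap.toAddMonoidHom_coe, this, hs, monomial_mul]
      · simp
    intro a x
    have hadd : ∀ a b : MvPolynomial σ K, (a + b) ^ p = a ^ p + b ^ p := fun a b =>
      add_pow_char _ _ p
    induction a using MvPolynomial.induction_on' with
    | monomial u a =>
      induction x using MvPolynomial.induction_on' with
      | monomial v c => exact hmm u a v c
      | add x y hx hy => rw [mul_add, map_add, map_add, hx, hy, mul_add]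
    | add a b ha hb => rw [hadd, add_mul, map_add, ha, hb, add_mul]
  · rintro u c ⟨i, hi⟩
    rw [hT]
    have : ¬ ∀ i, u i % p = p - 1 := by
      intro h
      have := h i
      have h2 := Nat.mod_le (u i) p
      omega
    simp [t, this]
  · intro u hu
    rw [hT]
    have h1 : ∀ i, u i % p = p - 1 := by
      intro i; rw [hu i]; exact Nat.mod_eq_of_lt (by omega)
    have h2 : d u = 0 := by
      ext i; simp [d, hu i]; omega
    simp only [t, if_pos h1, h2]
    simp [hs1]

/-- Number of the diagonal of a position. -/
def fsDiag {m n : ℕ} (c : Fin m × Fin n) : ℕ := (c.2 : ℕ) + m - c.1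

theorem fs_count (m n q : ℕ) :
    (Finset.univ.filter fun c : Fin m × Fin n => q ≤ (c.1 : ℕ) ∧ q ≤ (c.2 : ℕ)).card ≤
      ∑ d ∈ Finset.range (m + n),
        (Fintype.card {c : Fin m × Fin n // fsDiag c = d} - q) := by
  rw [Finset.card_eq_sum_card_fiberwise (f := fsDiag) (t := Finset.range (m + n))
    (by intro c _; have := c.1.2; have := c.2.2; simp [fsDiag]; omega)]
  refine Finset.sum_le_sum fun d _ => ?_
  rw [Fintype.card_subtype]
  set F := (Finset.univ.filter fun c : Fin m × Fin n => q ≤ (c.1 : ℕ) ∧ q ≤ (c.2 : ℕ)).filter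
    (fun c => fsDiag c = d) with hF
  rcases F.eq_empty_or_nonempty with h | ⟨c, hc⟩
  · simp [h]
  · have hc' : (q ≤ (c.1 : ℕ) ∧ q ≤ (c.2 : ℕ)) ∧ fsDiag c = d := by
      simpa [hF] using hc
    obtain ⟨⟨h1, h2⟩, h3⟩ := hc'
    have b1 := c.1.2
    have b2 := c.2.2
    let μ := min (c.1 : ℕ) (c.2 : ℕ)
    have hμ1 : μ ≤ c.1 := min_le_left _ _
    have hμ2 : μ ≤ c.2 := min_le_right _ _
    have hμ : q ≤ μ := le_min h1 h2
    have hμ3 : (c.1 : ℕ) - μ = 0 ∨ (c.2 : ℕ) - μ = 0 := by omega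
    let g : Fin q → Fin m × Fin n := fun r =>
      (⟨(c.1 : ℕ) - μ + r, by have := r.2; omega⟩, ⟨(c.2 : ℕ) - μ + r, by have := r.2; omega⟩)
    have hg : Function.Injective g := by
      intro a b hab
      have := congrArg (fun x : Fin m × Fin n => (x.1 : ℕ)) hab
      simp only [g] at this
      exact Fin.ext (by omega)
    have hdisj : Disjoint F (Finset.univ.image g) := by
      rw [Finset.disjoint_right]
      intro x hx hxF
      simp only [Finset.mem_image, Finset.mem_univ, true_and] at hx
      obtain ⟨r, rfl⟩ := hx
      simp only [hF, Finset.mem_filter, Finset.mem_univ, true_and, g] at hxF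
      have := r.2
      omega
    have hsub : F ∪ Finset.univ.image g ⊆ Finset.univ.filter fun c => fsDiag c = d := by
      intro x hx
      simp only [Finset.mem_union, Finset.mem_image, Finset.mem_univ, true_and, hF,
        Finset.mem_filter] at hx ⊢
      rcases hx with hx | ⟨r, rfl⟩
      · exact hx.2
      · rw [← h3]; simp only [fsDiag, g]; have := r.2; omega
    have := Finset.card_le_card hsub
    rw [Finset.card_union_of_disjoint hdisj, Finset.card_image_of_injective _ hg] at this
    simp only [Finset.card_univ, Fintype.card_fin] at this
    omega

/-- The generic matrix. -/
noncomputable def fsX (K : Type*) [Field K] (m n : ℕ) :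
    Matrix (Fin m) (Fin n) (MvPolynomial (Fin m × Fin n) K) := Matrix.of fun i j => X (i, j)

/-- The top left `q × q` block. -/
noncomputable def fsTop (K : Type*) [Field K] (m n q : ℕ) (hm : q ≤ m) (hn : q ≤ n) :
    Matrix (Fin q) (Fin q) (MvPolynomial (Fin m × Fin n) K) :=
  (fsX K m n).submatrix (Fin.castLE hm) (Fin.castLE hn)

/-- The (denominator free) Schur complement. -/
noncomputable def fsE (K : Type*) [Field K] (m n q : ℕ) (hm : q ≤ m) (hn : q ≤ n) :
    Matrix (Fin m) (Fin n) (MvPolynomial (Fin m × Fin n) K) :=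
  (fsTop K m n q hm hn).det • fsX K m n -
    (fsX K m n).submatrix id (Fin.castLE hn) * (fsTop K m n q hm hn).adjugate *
      (fsX K m n).submatrix (Fin.castLE hm) id

theorem fsE_row (K : Type*) [Field K] (m n q : ℕ) (hm : q ≤ m) (hn : q ≤ n) (i : Fin q)
    (j : Fin n) : fsE K m n q hm hn (Fin.castLE hm i) j = 0 := by
  have h : (fsE K m n q hm hn).submatrix (Fin.castLE hm) id = 0 := by
    have : (fsE K m n q hm hn).submatrix (Fin.castLE hm) id =
      (fsTop K m n q hm hn).det • (fsX K m n).submatrix (Fin.castLE hm) id -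
      fsTop K m n q hm hn * (fsTop K m n q hm hn).adjugate *
      (fsX K m n).submatrix (Fin.castLE hm) id := rfl
    rw [this, Matrix.mul_adjugate, Matrix.smul_mul, Matrix.one_mul, sub_self]
  exact congrFun (congrFun h i) j

theorem fsE_col (K : Type*) [Field K] (m n q : ℕ) (hm : q ≤ m) (hn : q ≤ n) (i : Fin m)
    (j : Fin q) : fsE K m n q hm hn i (Fin.castLE hn j) = 0 := by
  have h : (fsE K m n q hm hn).submatrix id (Fin.castLE hn) = 0 := by
    have : (fsE K m n q hm hn).submatrix id (Fin.castLE hn) =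
      (fsTop K m n q hm hn).det • (fsX K m n).submatrix id (Fin.castLE hn) -
      (fsX K m n).submatrix id (Fin.castLE hn) * (fsTop K m n q hm hn).adjugate *
      fsTop K m n q hm hn := rfl
    rw [this, Matrix.mul_assoc, Matrix.adjugate_mul, Matrix.mul_smul, Matrix.mul_one, sub_self]
  exact congrFun (congrFun h i) j

/-- The map `X ↦ Y Z`. -/
noncomputable def fsPsi (K : Type*) [Field K] (m n q : ℕ) :
    MvPolynomial (Fin m × Fin n) K →+* MvPolynomial ((Fin m × Fin q) ⊕ (Fin q × Fin n)) K :=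
  ((fsB K m n q).comp (fsA K m n q)).toRingHom

theorem fsPsi_X (K : Type*) [Field K] (m n q : ℕ) (i : Fin m) (j : Fin n) :
    fsPsi K m n q (X (i, j)) = ∑ k, X (Sum.inl (i, k)) * X (Sum.inr (k, j)) := by
  simp [fsPsi, fsA, fsB]

theorem fsPsi_E (K : Type*) [Field K] (m n q : ℕ) (hm : q ≤ m) (hn : q ≤ n) (i : Fin m)
    (j : Fin n) : fsPsi K m n q (fsE K m n q hm hn i j) = 0 := by
  let Y : Matrix (Fin m) (Fin q) (MvPolynomial ((Fin m × Fin q) ⊕ (Fin q × Fin n)) K) :=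
    Matrix.of fun i k => X (Sum.inl (i, k))
  let Z : Matrix (Fin q) (Fin n) (MvPolynomial ((Fin m × Fin q) ⊕ (Fin q × Fin n)) K) :=
    Matrix.of fun k j => X (Sum.inr (k, j))
  let YA := Y.submatrix (Fin.castLE hm) id
  let ZA := Z.submatrix id (Fin.castLE hn)
  have hX : (fsX K m n).map (fsPsi K m n q) = Y * Z := by
    ext1 i j
    simp [fsX, fsPsi_X, Matrix.mul_apply, Y, Z]
  have hT : (fsTop K m n q hm hn).map (fsPsi K m n q) = YA * ZA := by
    rw [fsTop, ← Matrix.submatrix_map, hX]; rfl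
  have hC : ((fsX K m n).submatrix id (Fin.castLE hn)).map (fsPsi K m n q) = Y * ZA := by
    rw [← Matrix.submatrix_map, hX]; rfl
  have hD : ((fsX K m n).submatrix (Fin.castLE hm) id).map (fsPsi K m n q) = YA * Z := by
    rw [← Matrix.submatrix_map, hX]; rfl
  have hdet : fsPsi K m n q (fsTop K m n q hm hn).det = YA.det * ZA.det := by
    rw [RingHom.map_det, RingHom.mapMatrix_apply, hT, Matrix.det_mul]
  have hadj : (fsTop K m n q hm hn).adjugate.map (fsPsi K m n q)
      = ZA.adjugate * YA.adjugate := by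
    rw [← RingHom.mapMatrix_apply, RingHom.map_adjugate, RingHom.mapMatrix_apply, hT,
      Matrix.adjugate_mul_distrib]
  have h : (fsE K m n q hm hn).map (fsPsi K m n q) = 0 := by
    rw [fsE, Matrix.map_sub _ (fun a b => map_sub _ a b), Matrix.map_mul, Matrix.map_mul, hC, hD,
      hadj]
    have hs : ((fsTop K m n q hm hn).det • fsX K m n).map (fsPsi K m n q)
        = (YA.det * ZA.det) • (Y * Z) := by
      rw [← hX, ← hdet]
      ext1 i j
      simp
    rw [hs]
    have : Y * ZA * (ZA.adjugate * YA.adjugate) * (YA * Z)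
        = Y * ((ZA * ZA.adjugate) * (YA.adjugate * YA)) * Z := by
      simp only [Matrix.mul_assoc]
    rw [this, Matrix.mul_adjugate, Matrix.adjugate_mul]
    simp [smul_smul, mul_comm]
  exact congrFun (congrFun h i) j

theorem fsPsi_det_ne (K : Type*) [Field K] (m n q : ℕ) (hm : q ≤ m) (hn : q ≤ n) :
    fsPsi K m n q (fsTop K m n q hm hn).det ≠ 0 := by
  let e : MvPolynomial ((Fin m × Fin q) ⊕ (Fin q × Fin n)) K →+* K :=
    eval (Sum.elim (fun x => if (x.1 : ℕ) = x.2 then 1 else 0)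
      (fun x => if (x.1 : ℕ) = x.2 then 1 else 0))
  intro h
  have h1 : e (fsPsi K m n q (fsTop K m n q hm hn).det) = 0 := by rw [h, map_zero]
  rw [← RingHom.comp_apply, RingHom.map_det, RingHom.mapMatrix_apply] at h1
  have h2 : (fsTop K m n q hm hn).map (e.comp (fsPsi K m n q)) = 1 := by
    ext1 i j
    simp only [fsTop, fsX, Matrix.map_apply, Matrix.submatrix_apply, Matrix.of_apply,
      RingHom.comp_apply, fsPsi_X, map_sum, map_mul, e, eval_X, Sum.elim_inl, Sum.elim_inr,
      Fin.val_castLE, Matrix.one_apply]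
    rw [Finset.sum_eq_single i]
    · simp [Fin.ext_iff]
    · intro k _ hk
      rw [if_neg (fun h => hk (Fin.ext h.symm)), zero_mul]
    · simp
  rw [h2, Matrix.det_one] at h1
  exact one_ne_zero h1

/-- The ideal generated by the entries of the Schur complement. -/
noncomputable def fsJ (K : Type*) [Field K] (m n q : ℕ) (hm : q ≤ m) (hn : q ≤ n) :
    Ideal (MvPolynomial (Fin m × Fin n) K) :=
  Ideal.span ((fun c : Fin m × Fin n => fsE K m n q hm hn c.1 c.2) ''
    (Finset.univ.filter fun c : Fin m × Fin n => q ≤ (c.1 : ℕ) ∧ q ≤ (c.2 : ℕ) :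
      Finset (Fin m × Fin n)))

theorem fsE_mem (K : Type*) [Field K] (m n q : ℕ) (hm : q ≤ m) (hn : q ≤ n) (i : Fin m)
    (j : Fin n) : fsE K m n q hm hn i j ∈ fsJ K m n q hm hn := by
  by_cases hi : (i : ℕ) < q
  · rw [show i = Fin.castLE hm ⟨i, hi⟩ from rfl, fsE_row]; exact zero_mem _
  by_cases hj : (j : ℕ) < q
  · rw [show j = Fin.castLE hn ⟨j, hj⟩ from rfl, fsE_col]; exact zero_mem _
  exact Ideal.subset_span ⟨(i, j), by simp; omega, rfl⟩

theorem fs_minor_mem (K : Type*) [Field K] (m n q : ℕ) (hm : q ≤ m) (hn : q ≤ n) {ι : Type*}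
    [Fintype ι] [DecidableEq ι] (r : ι → Fin m) (c : ι → Fin n) :
    (fsTop K m n q hm hn).det ^ Fintype.card ι *
      Matrix.det (Matrix.of fun i j => (X (r i, c j) : MvPolynomial _ K)) ∈
      fsJ K m n q hm hn ^ (Fintype.card ι - q) := by
  rw [← Matrix.det_smul]
  have h := fs_det_mem_pow (fsJ K m n q hm hn) ((fsE K m n q hm hn).submatrix r c)
    (fun i j => fsE_mem K m n q hm hn _ _)
    (-((fsX K m n).submatrix r (Fin.castLE hn) * (fsTop K m n q hm hn).adjugate))
    ((fsX K m n).submatrix (Fin.castLE hm) c)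
  rw [Fintype.card_fin] at h
  convert h using 2
  have : (fsE K m n q hm hn).submatrix r c = 
    (fsTop K m n q hm hn).det • (fsX K m n).submatrix r c -
    (fsX K m n).submatrix r (Fin.castLE hn) * (fsTop K m n q hm hn).adjugate *
      (fsX K m n).submatrix (Fin.castLE hm) c := rfl
  rw [this, Matrix.neg_mul, sub_neg_eq_add, sub_add_cancel]
  rfl

/-- The product of the main diagonal minors. -/
noncomputable def fsF (K : Type*) [Field K] (m n : ℕ) : MvPolynomial (Fin m × Fin n) K :=
  ∏ d ∈ Finset.range (m + n), Matrix.det (Matrix.of fun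
    (a b : {c : Fin m × Fin n // fsDiag c = d}) => (X (a.1.1, b.1.2) : MvPolynomial _ K))

theorem fsF_lead (K : Type*) [Field K] (m n : ℕ) :
    FSLead (fsW m n) (fsF K m n) (∑ c, Finsupp.single c 1) := by
  have h : FSLead (fsW m n) (fsF K m n) (∑ d ∈ Finset.range (m + n),
      ∑ a : {c : Fin m × Fin n // fsDiag c = d}, Finsupp.single (a.1.1, a.1.2) 1) := by
    refine FSLead.prod _ fun d _ => ?_
    refine fs_det_lead (fun a : {c : Fin m × Fin n // fsDiag c = d} => a.1.1) (fun a => a.1.2) ?_ ?_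
    · rintro ⟨⟨i, j⟩, ha⟩ ⟨⟨i', j'⟩, hb⟩ hab
      simp only [fsDiag] at ha hb hab
      subst hab
      have : j = j' := Fin.ext (by have := i.2; omega)
      subst this; rfl
    · rintro ⟨⟨i, j⟩, ha⟩ ⟨⟨i', j'⟩, hb⟩ hab
      simp only [fsDiag] at ha hb hab ⊢
      rw [Fin.lt_def] at *
      have := i.2; have := i'.2
      omega
  convert h using 1
  rw [← Finset.sum_fiberwise_of_maps_to (g := fsDiag) (t := Finset.range (m + n))
    (by intro c _; have := c.1.2; have := c.2.2; simp [fsDiag]; omega)]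
  refine Finset.sum_congr rfl fun d _ => ?_
  exact Finset.sum_subtype _ (by simp) _

theorem fsF_mem (K : Type*) [Field K] (m n q : ℕ) (hm : q ≤ m) (hn : q ≤ n) :
    ∃ N, (fsTop K m n q hm hn).det ^ N * fsF K m n ∈ fsJ K m n q hm hn ^
      (Finset.univ.filter fun c : Fin m × Fin n => q ≤ (c.1 : ℕ) ∧ q ≤ (c.2 : ℕ)).card := by
  refine ⟨∑ d ∈ Finset.range (m + n), Fintype.card {c : Fin m × Fin n // fsDiag c = d}, ?_⟩
  rw [fsF, ← Finset.prod_pow_eq_pow_sum, ← Finset.prod_mul_distrib]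
  refine Ideal.pow_le_pow_right (fs_count m n q) ?_
  rw [← Finset.prod_pow_eq_pow_sum]
  exact Ideal.prod_mem_prod fun d _ => fs_minor_mem K m n q hm hn _ _

end FSplitHelpers

/-- In positive characteristic `p`, the determinantal ring `S/I_t(X)` of a generic
`m × n` matrix is F-split: there is an additive map `φ` with `φ (a ^ p * x) = a * φ x`
and `φ 1 = 1` (a splitting of the Frobenius endomorphism). -/
theorem determinantal_generic_FSplit (K : Type*) [Field K] (p : ℕ) [Fact p.Prime]
    [CharP K p] (m n : ℕ) (hm : 0 < m) (hmn : m < n)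
    (t : ℕ) (ht1 : 1 ≤ t) (htm : t ≤ m) :
    ∃ φ : (MvPolynomial (Fin m × Fin n) K ⧸ genMinors K m n t 1 m 1 n) →
          (MvPolynomial (Fin m × Fin n) K ⧸ genMinors K m n t 1 m 1 n),
      (∀ x y, φ (x + y) = φ x + φ y) ∧
      (∀ a x, φ (a ^ p * x) = a * φ x) ∧
      φ 1 = 1 := by
    classical
  obtain ⟨q, rfl⟩ : ∃ q, t = q + 1 := ⟨t - 1, by omega⟩
  have hqm : q ≤ m := by omega
  have hqn : q ≤ n := by omega
  obtain ⟨p', hp'⟩ : ∃ p', p = p' + 1 :=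
    ⟨p - 1, by have := (Fact.out : p.Prime).pos; omega⟩
  set I := genMinors K m n (q + 1) 1 m 1 n with hIdef
  have hI : ∀ (r : Fin (q + 1) → Fin m) (c : Fin (q + 1) → Fin n), StrictMono r → StrictMono c →
      Matrix.det (Matrix.of fun i j => (MvPolynomial.X (r i, c j) : MvPolynomial _ K)) ∈ I := by
    intro r c hr hc
    refine Ideal.subset_span ⟨r, c, hr, hc, ?_, ?_, rfl⟩
    · intro i; have := (r i).2; omega
    · intro i; have := (c i).2; omega
  set δ := (fsTop K m n q hqm hqn).det with hδ
  have hδne : fsPsi K m n q δ ≠ 0 := fsPsi_det_ne K m n q hqm hqn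
  have hcancel : ∀ k y, fsPsi K m n q (δ ^ k * y) = 0 → fsPsi K m n q y = 0 := by
    intro k y h
    rw [map_mul, map_pow] at h
    exact (mul_eq_zero.1 h).resolve_left (pow_ne_zero _ hδne)
  have hIJ : ∀ a ∈ I, δ ^ (q + 1) * a ∈ fsJ K m n q hqm hqn := by
    intro a ha
    rw [hIdef, genMinors] at ha
    refine Submodule.span_induction ?_ ?_ ?_ ?_ ha
    · rintro _ ⟨r, c, -, -, -, -, rfl⟩
      have := fs_minor_mem K m n q hqm hqn r c
      simpa using this
    · simp
    · intro x y _ _ hx hy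
      rw [mul_add]; exact add_mem hx hy
    · intro s x _ hx
      rw [smul_eq_mul, mul_left_comm]; exact Ideal.mul_mem_left _ _ hx
  have hJker : ∀ a ∈ fsJ K m n q hqm hqn, fsPsi K m n q a = 0 := by
    intro a ha
    have : fsJ K m n q hqm hqn ≤ RingHom.ker (fsPsi K m n q) := by
      rw [fsJ, Ideal.span_le]
      rintro _ ⟨c, -, rfl⟩
      exact fsPsi_E K m n q hqm hqn _ _
    exact this ha
  have hker : ∀ g, fsPsi K m n q g = 0 → g ∈ I :=
    fs_ker_le K m n q I hI fun a ha => hcancel _ a (hJker _ (hIJ a ha))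
  obtain ⟨T, hT1, hT2, hT3⟩ := fs_trace K (Fin m × Fin n) p
  have hspan : ∀ y ∈ Ideal.span ((fun c : Fin m × Fin n => fsE K m n q hqm hqn c.1 c.2 ^ (p' + 1)) ''
      (Finset.univ.filter fun c : Fin m × Fin n => q ≤ (c.1 : ℕ) ∧ q ≤ (c.2 : ℕ) :
      Finset (Fin m × Fin n))), ∀ s, fsPsi K m n q (T (y * s)) = 0 := by
    intro y hy
    refine Submodule.span_induction ?_ ?_ ?_ ?_ hy
    · rintro _ ⟨c, -, rfl⟩ s
      dsimp only
      rw [← hp', hT1, map_mul, fsPsi_E, zero_mul]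
    · simp
    · intro x y _ _ hx hy s
      rw [add_mul, map_add, map_add, hx, hy, add_zero]
    · intro r x _ hx s
      rw [smul_eq_mul, mul_comm r, mul_assoc]; exact hx _
  obtain ⟨N, hN⟩ := fsF_mem K m n q hqm hqn
  set f := fsF K m n with hf
  have hcompat : ∀ a ∈ I, T (f ^ p' * a) ∈ I := by
    intro a ha
    apply hker
    have h1 := Ideal.mul_mem_mul (Ideal.pow_mem_pow hN p') (hIJ a ha)
    rw [← pow_mul, ← pow_succ] at h1
    have h2 := hspan _ (fs_pigeon _ _ _ h1) (δ ^ ((N * p' + q + 1) * p'))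
    apply hcancel (N * p' + q + 1)
    rw [← hT1, ← h2]
    congr 2
    rw [hp', ← hδ]
    ring
  have hT_one : T (f ^ p' * 1) = 1 := by
    have hl := (fsF_lead K m n).pow p'
    rw [← hf] at hl
    unfold FSLead at hl
    set u : (Fin m × Fin n) →₀ ℕ := p' • ∑ c, Finsupp.single c 1 with hu
    have hu' : ∀ i, u i = p - 1 := by
      intro i
      simp [hu, Finsupp.finsetSum_apply, Finsupp.single_apply, hp']
    have hz : T (f ^ p' - MvPolynomial.monomial u 1) = 0 := by
      have hsum := MvPolynomial.as_sum (f ^ p' - MvPolynomial.monomial u (1 : K))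
      rw [hsum, map_sum]
      refine Finset.sum_eq_zero fun v hv => hT2 _ _ ?_
      by_contra hcon
      push Not at hcon
      have h1 : fsW m n v < fsW m n u := hl hv
      rw [fsW_apply, fsW_apply] at h1
      refine absurd h1 (not_lt.2 (Finset.sum_le_sum fun c _ => Nat.mul_le_mul_right _ ?_))
      rw [hu']; exact hcon c
    rw [map_sub, hT3 u hu', sub_eq_zero] at hz
    rw [mul_one, hz]
  have hsurj := Ideal.Quotient.mk_surjective (I := I)
  let φ : (MvPolynomial (Fin m × Fin n) K ⧸ I) → (MvPolynomial (Fin m × Fin n) K ⧸ I) :=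
    fun x => Ideal.Quotient.mk I (T (f ^ p' * Function.surjInv hsurj x))
  have hφ : ∀ a, φ (Ideal.Quotient.mk I a) = Ideal.Quotient.mk I (T (f ^ p' * a)) := by
    intro a
    have h1 := Function.surjInv_eq hsurj (Ideal.Quotient.mk I a)
    rw [Ideal.Quotient.eq] at h1
    have h2 := hcompat _ h1
    rw [mul_sub, map_sub] at h2
    exact Ideal.Quotient.eq.2 h2
  refine ⟨φ, ?_, ?_, ?_⟩
  · intro x y
    obtain ⟨a, rfl⟩ := hsurj x
    obtain ⟨b, rfl⟩ := hsurj y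
    rw [← map_add, hφ, hφ, hφ, mul_add, map_add, map_add]
  · intro x y
    obtain ⟨a, rfl⟩ := hsurj x
    obtain ⟨b, rfl⟩ := hsurj y
    rw [← map_pow, ← map_mul, hφ, hφ, ← map_mul, mul_left_comm, hT1]
  · rw [← map_one (Ideal.Quotient.mk I), hφ, hT_one]
end

section
/- Let K be a field, m < n positive integers, X the m×n generic matrix over S = K[x_{ij}], and let ≺ be a diagonal monomial order on S (a monomial order such that the leading monomial of every minor of X is the product of the entries on its main diagonal). Let I = I_1 + I_2 + ... + I_k, where each I_i is either I_{t_i}(X_{[a_i,b_i]}) (minors on consecutive columns a_i,...,b_i) or I_{t_i}(X^{[a_i,b_i]}) (minors on consecutive rows a_i,...,b_i). If G_i is a Gröbner basis of I_i with respect to ≺ for each i, then G_1 ∪ G_2 ∪ ... ∪ G_k is a Gröbner basis of I with respect to ≺; equivalently, the initial ideal of I equals the sum of the initial ideals of the I_i. -/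
/-- The exponent of the leading monomial of a multivariate polynomial with respect to a
monomial order (the maximum of its support); it is `0` for the zero polynomial. -/
noncomputable def leadExp {σ K : Type*} [Field K] (ord : MonomialOrder σ)
    (p : MvPolynomial σ K) : σ →₀ ℕ :=
  ord.toSyn.symm (p.support.sup fun d => ord.toSyn d)

/-- The initial ideal of `J` with respect to a monomial order: the ideal generated by the
leading monomials of the nonzero elements of `J`. -/
noncomputable def initialIdeal {σ K : Type*} [Field K] (ord : MonomialOrder σ)
    (J : Ideal (MvPolynomial σ K)) : Ideal (MvPolynomial σ K) :=
  Ideal.span { q | ∃ p ∈ J, p ≠ 0 ∧ q = MvPolynomial.monomial (leadExp ord p) (1 : K) }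

/-- A finite subset `G ⊆ J` is a Gröbner basis of `J` w.r.t. a monomial order if the leading
monomials of the elements of `G` generate the initial ideal of `J`. -/
def IsGroebnerBasis {σ K : Type*} [Field K] (ord : MonomialOrder σ)
    (G : Set (MvPolynomial σ K)) (J : Ideal (MvPolynomial σ K)) : Prop :=
  G.Finite ∧ G ⊆ (J : Set (MvPolynomial σ K)) ∧
    Ideal.span { q | ∃ p ∈ G, p ≠ 0 ∧ q = MvPolynomial.monomial (leadExp ord p) (1 : K) }
      = initialIdeal ord J

/-- A monomial order on `K[x_{ij}]` is diagonal if the leading monomial of the determinant of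
every square submatrix of the generic matrix (rows and columns chosen strictly monotonically)
is the product of the entries on its main diagonal. -/
def IsDiagonalOrder (K : Type*) [Field K] (m n : ℕ)
    (ord : MonomialOrder (Fin m × Fin n)) : Prop :=
  ∀ (s : ℕ) (r : Fin s → Fin m) (c : Fin s → Fin n), StrictMono r → StrictMono c →
    leadExp ord (Matrix.det (Matrix.of fun i j =>
        (MvPolynomial.X (r i, c j) : MvPolynomial (Fin m × Fin n) K)))
      = ∑ i, Finsupp.single (r i, c i) 1


namespace GBU

/-- Potentials making an antichain tight. -/
lemma potential {Γ : Type*} [AddCommGroup Γ] [LinearOrder Γ] [IsOrderedAddMonoid Γ]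
    (m n : ℕ) (hm : 0 < m) (E : ℕ → ℕ → Γ)
    (hE : ∀ i k j l, i < k → k < m → j < l → l < n → E i l + E k j ≤ E i j + E k l)
    (Q : Finset (ℕ × ℕ)) (hQm : ∀ v ∈ Q, v.1 < m) (hQn : ∀ v ∈ Q, v.2 < n)
    (hQ : ∀ v ∈ Q, ∀ w ∈ Q, v.1 < w.1 → ¬ v.2 < w.2) :
    ∃ α β : ℕ → Γ, (∀ i j, i < m → α i + β j ≤ E i j) ∧
      (∀ v ∈ Q, α v.1 + β v.2 = E v.1 v.2) := by
  classical
  let c : ℕ → ℕ := fun l => (Q.filter (fun v => l < v.1)).sup (fun v => v.2)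
  let α : ℕ → Γ := fun i => ∑ l ∈ Finset.range i, (E (l+1) (c l) - E l (c l))
  have hα : ∀ i, α (i+1) = α i + (E (i+1) (c i) - E i (c i)) := fun i => by
    simp only [α, Finset.sum_range_succ]
  have hne : (Finset.range m).Nonempty := ⟨0, by simpa using hm⟩
  let β : ℕ → Γ := fun j => (Finset.range m).inf' hne (fun i => E i j - α i)
  refine ⟨α, β, ?_, ?_⟩
  · intro i j hi
    have : β j ≤ E i j - α i := Finset.inf'_le _ (by simpa using hi)
    have := add_le_add_right this (α i)
    simpa using this
  · intro v hv
    have hkey : ∀ i', i' < m → E v.1 v.2 - α v.1 ≤ E i' v.2 - α i' := by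
      have up : ∀ d, v.1 + d < m → E v.1 v.2 - α v.1 ≤ E (v.1+d) v.2 - α (v.1+d) := by
        intro d
        induction d with
        | zero => intro _; simp
        | succ d ih =>
          intro hd
          refine (ih (by omega)).trans ?_
          have hc : c (v.1 + d) ≤ v.2 := by
            refine Finset.sup_le ?_
            intro w hw
            rw [Finset.mem_filter] at hw
            exact not_lt.mp (hQ v hv w hw.1 (by omega))
          rw [← add_assoc, hα]
          rcases hc.eq_or_lt with h | h
          · rw [h]; apply le_of_eq; abel
          · have := hE (v.1+d) (v.1+d+1) _ _ (by omega) (by omega) h (hQn v hv)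
            rw [sub_le_sub_iff]
            have h2 := add_le_add_right this (α (v.1+d) - E (v.1+d) (c (v.1+d)))
            convert h2 using 1 <;> abel
      have down : ∀ d, d ≤ v.1 → E v.1 v.2 - α v.1 ≤ E (v.1-d) v.2 - α (v.1-d) := by
        intro d
        induction d with
        | zero => intro _; simp
        | succ d ih =>
          intro hd
          refine (ih (by omega)).trans ?_
          have hvm := hQm v hv
          obtain ⟨i, hi⟩ : ∃ i, v.1 - (d+1) = i := ⟨_, rfl⟩
          have hi2 : v.1 - d = i + 1 := by omega
          rw [hi, hi2]
          have hc : v.2 ≤ c i := Finset.le_sup (f := fun v : ℕ × ℕ => v.2)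
            (Finset.mem_filter.mpr ⟨hv, by omega⟩)
          have hcn : c i < n := by
            refine (Finset.sup_lt_iff (lt_of_le_of_lt (Nat.zero_le _) (hQn v hv))).mpr ?_
            intro w hw
            exact hQn w (Finset.mem_filter.mp hw).1
          rw [hα]
          rcases hc.eq_or_lt with h | h
          · rw [← h]; apply le_of_eq; abel
          · have := hE i (i+1) _ _ (by omega) (by omega) h hcn
            rw [sub_le_sub_iff]
            have h2 := add_le_add_right this (α i - E i (c i))
            convert h2 using 1 <;> abel
      intro i' hi'
      rcases le_total v.1 i' with h | h
      · have := up (i' - v.1) (by omega)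
        rwa [show v.1 + (i' - v.1) = i' by omega] at this
      · have := down (v.1 - i') (by omega)
        rwa [show v.1 - (v.1 - i') = i' by omega] at this
    have : β v.2 = E v.1 v.2 - α v.1 := by
      apply le_antisymm
      · exact Finset.inf'_le _ (by simpa using hQm v hv)
      · refine Finset.le_inf' _ _ ?_
        intro i hi
        exact hkey i (by simpa using hi)
    rw [this]; abel

/-- `U` contains a strict chain of length `s`. -/
def HasChain {m n : ℕ} (U : Finset (Fin m × Fin n)) (s : ℕ) : Prop :=
  ∃ (r : Fin s → Fin m) (c : Fin s → Fin n), StrictMono r ∧ StrictMono c ∧ ∀ i, (r i, c i) ∈ U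

lemma levels {m n : ℕ} (s : ℕ) : ∀ (U : Finset (Fin m × Fin n)), ¬ HasChain U (s+1) →
    ∃ lev : Fin m × Fin n → ℕ, (∀ v ∈ U, lev v < s) ∧
      ∀ v ∈ U, ∀ w ∈ U, lev v = lev w → v.1 < w.1 → ¬ v.2 < w.2 := by
  classical
  induction s with
  | zero =>
    intro U hU
    have : U = ∅ := by
      by_contra h
      obtain ⟨v, hv⟩ := Finset.nonempty_iff_ne_empty.mpr h
      exact hU ⟨fun _ => v.1, fun _ => v.2,
        fun a b h => by have := a.2; have := b.2; rw [Fin.lt_def] at h; omega,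
        fun a b h => by have := a.2; have := b.2; rw [Fin.lt_def] at h; omega,
        fun _ => hv⟩
    subst this
    exact ⟨fun _ => 0, by simp, by simp⟩
  | succ s ih =>
    intro U hU
    let V := U.filter (fun v => ∃ u ∈ U, u.1 < v.1 ∧ u.2 < v.2)
    have hV : ¬ HasChain V (s+1) := by
      rintro ⟨r, c, hr, hc, h⟩
      obtain ⟨h0, u, hu, h1, h2⟩ := Finset.mem_filter.mp (h 0)
      refine hU ⟨Fin.cons u.1 r, Fin.cons u.2 c, ?_, ?_, ?_⟩
      · refine Fin.strictMono_iff_lt_succ.mpr ?_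
        intro i
        refine Fin.cases ?_ (fun i => ?_) i
        · simpa using h1
        · simp only [Fin.cons_succ, Fin.castSucc_succ]
          exact hr (Fin.castSucc_lt_succ)
      · refine Fin.strictMono_iff_lt_succ.mpr ?_
        intro i
        refine Fin.cases ?_ (fun i => ?_) i
        · simpa using h2
        · simp only [Fin.cons_succ, Fin.castSucc_succ]
          exact hc (Fin.castSucc_lt_succ)
      · intro i
        refine Fin.cases ?_ (fun i => ?_) i
        · simpa using hu
        · simpa using (Finset.mem_filter.mp (h i)).1
    obtain ⟨lev, hl1, hl2⟩ := ih V hV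
    refine ⟨fun v => if v ∈ V then lev v else s, ?_, ?_⟩
    · intro v _
      dsimp only
      split_ifs with h
      · exact (hl1 v h).trans (Nat.lt_succ_self s)
      · exact Nat.lt_succ_self s
    · intro v hv w hw hvw h1 h2
      have hwV : w ∈ V := Finset.mem_filter.mpr ⟨hw, v, hv, h1, h2⟩
      by_cases hvV : v ∈ V
      · simp only [hwV, hvV, if_true] at hvw
        exact hl2 v hvV w hwV hvw h1 h2
      · simp only [hwV, hvV, if_true, if_false] at hvw
        have := hl1 w hwV
        omega

/-- A square matrix which factors through a smaller index type has determinant zero. -/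
lemma det_mul_eq_zero {R ι κ : Type*} [CommRing R] [Fintype ι] [DecidableEq ι] [Fintype κ]
    (A : Matrix ι κ R) (B : Matrix κ ι R) (h : Fintype.card κ < Fintype.card ι) :
    (A * B).det = 0 := by
  classical
  obtain ⟨e⟩ : Nonempty (κ ↪ ι) := Function.Embedding.nonempty_of_card_le h.le
  obtain ⟨j0, hj0⟩ : ∃ j0, j0 ∉ Set.range e := by
    by_contra hcon
    push Not at hcon
    have : Function.Surjective e := fun x => hcon x
    exact absurd (Fintype.card_le_of_surjective _ this) (by omega)
  let A' : Matrix ι ι R := Matrix.of fun i j => if h : ∃ k, e k = j then A i h.choose else 0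
  let B' : Matrix ι ι R := Matrix.of fun j i => if h : ∃ k, e k = j then B h.choose i else 0
  have hAe : ∀ i k, A' i (e k) = A i k := by
    intro i k
    have hex : ∃ k', e k' = e k := ⟨k, rfl⟩
    simp only [A', Matrix.of_apply, dif_pos hex]
    rw [e.injective hex.choose_spec]
  have hBe : ∀ i k, B' (e k) i = B k i := by
    intro i k
    have hex : ∃ k', e k' = e k := ⟨k, rfl⟩
    simp only [B', Matrix.of_apply, dif_pos hex]
    rw [e.injective hex.choose_spec]
  have hAB : A * B = A' * B' := by
    ext i j
    rw [Matrix.mul_apply, Matrix.mul_apply]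
    rw [← Finset.sum_subset (Finset.subset_univ (Finset.univ.map e))]
    · rw [Finset.sum_map]
      refine Finset.sum_congr rfl fun k _ => ?_
      rw [hAe, hBe]
    · intro x _ hx
      have : ¬ ∃ k, e k = x := by simpa using hx
      simp only [A', Matrix.of_apply, dif_neg this, zero_mul]
  rw [hAB, Matrix.det_mul, Matrix.det_eq_zero_of_column_eq_zero j0, zero_mul]
  intro i
  have : ¬ ∃ k, e k = j0 := by simpa using hj0
  simp only [A', Matrix.of_apply, dif_neg this]

end GBU

namespace GBU

/-- Membership of a cell in the rectangle used by `genMinors`. -/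
def inRect {m n : ℕ} (r1 r2 c1 c2 : ℕ) (v : Fin m × Fin n) : Prop :=
  (r1 ≤ v.1.val + 1 ∧ v.1.val + 1 ≤ r2) ∧ (c1 ≤ v.2.val + 1 ∧ v.2.val + 1 ≤ c2)

/-- `u` is divisible by the diagonal of a `t`-minor in the rectangle. -/
def DiagDvd {m n : ℕ} (t r1 r2 c1 c2 : ℕ) (u : (Fin m × Fin n) →₀ ℕ) : Prop :=
  ∃ (r : Fin t → Fin m) (c : Fin t → Fin n), StrictMono r ∧ StrictMono c ∧
    (∀ i, r1 ≤ (r i).val + 1 ∧ (r i).val + 1 ≤ r2) ∧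
    (∀ j, c1 ≤ (c j).val + 1 ∧ (c j).val + 1 ≤ c2) ∧ ∀ i, (r i, c i) ∈ u.support

lemma eval_ne_zero {σ K Γ H : Type*} [Field K] [AddCommGroup Γ] [LinearOrder Γ]
    [IsOrderedAddMonoid Γ] [CommRing H] [Algebra K H]
    (v : AddValuation H (WithTop Γ)) (hv : ∀ a : K, a ≠ 0 → v (algebraMap K H a) = 0)
    (e : (σ →₀ ℕ) →+ Γ) (M : σ → H)
    (g : MvPolynomial σ K) (u : σ →₀ ℕ) (hu : u ∈ g.support)
    (hlt : ∀ w ∈ g.support, w ≠ u → e w < e u)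
    (h1 : ∀ x, ((-(e (Finsupp.single x 1)) : Γ) : WithTop Γ) ≤ v (M x))
    (h2 : ∀ x ∈ u.support, ((-(e (Finsupp.single x 1)) : Γ) : WithTop Γ) = v (M x)) :
    MvPolynomial.aeval M g ≠ 0 := by
  classical
  have hew : ∀ w : σ →₀ ℕ, e w = w.sum fun x k => k • e (Finsupp.single x 1) := by
    intro w
    conv_lhs => rw [← Finsupp.sum_single w]
    rw [Finsupp.sum, map_sum]
    refine Finset.sum_congr rfl fun x _ => ?_
    show _ = w x • e (Finsupp.single x 1)
    rw [← map_nsmul, Finsupp.smul_single]; simp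
  have hvprod : ∀ (w : σ →₀ ℕ), v (w.prod fun x k => M x ^ k) = ∑ x ∈ w.support, w x • v (M x) := by
    intro w
    rw [Finsupp.prod]
    induction w.support using Finset.induction_on with
    | empty => simp
    | insert a s ha ih => rw [Finset.prod_insert ha, Finset.sum_insert ha, v.map_mul, v.map_pow, ih]
  have hsum : ∀ w : σ →₀ ℕ, ((-(e w) : Γ) : WithTop Γ) =
      ∑ x ∈ w.support, w x • ((-(e (Finsupp.single x 1)) : Γ) : WithTop Γ) := by
    intro w
    rw [hew w, Finsupp.sum, ← Finset.sum_neg_distrib]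
    rw [WithTop.coe_sum]
    refine Finset.sum_congr rfl fun x _ => ?_
    rw [← smul_neg]
    rfl
  have hge : ∀ w : σ →₀ ℕ, ((-(e w) : Γ) : WithTop Γ) ≤ v (w.prod fun x k => M x ^ k) := by
    intro w
    rw [hvprod, hsum]
    exact Finset.sum_le_sum fun x _ => nsmul_le_nsmul_right (h1 x) _
  have heq : ((-(e u) : Γ) : WithTop Γ) = v (u.prod fun x k => M x ^ k) := by
    rw [hvprod, hsum]
    exact Finset.sum_congr rfl fun x hx => by rw [h2 x hx]
  intro h0
  have hterm : ∀ w ∈ g.support, v (algebraMap K H (g.coeff w) * w.prod fun x k => M x ^ k) =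
      v (w.prod fun x k => M x ^ k) := by
    intro w hw
    rw [v.map_mul, hv _ (MvPolynomial.mem_support_iff.mp hw), zero_add]
  rw [MvPolynomial.aeval_def, MvPolynomial.eval₂_eq] at h0
  rw [← Finset.add_sum_erase _ _ hu] at h0
  have hrest : ((-(e u) : Γ) : WithTop Γ) < v (∑ w ∈ g.support.erase u,
      algebraMap K H (g.coeff w) * ∏ i ∈ w.support, M i ^ w i) := by
    apply v.map_lt_sum (WithTop.coe_ne_top)
    intro w hw
    rw [Finset.mem_erase] at hw
    have := hterm w hw.2
    rw [Finsupp.prod] at this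
    rw [this]
    refine lt_of_lt_of_le ?_ (hge w)
    rw [WithTop.coe_lt_coe]
    exact neg_lt_neg (hlt w hw.2 hw.1)
  have hfst := hterm u hu
  rw [← heq, Finsupp.prod] at hfst
  have := v.map_add_eq_of_lt_left (hfst.trans_lt hrest)
  rw [h0, hfst, v.map_zero] at this
  exact WithTop.coe_ne_top this.symm

theorem diag_of_mem {K Γ : Type*} [Field K] {m n : ℕ} [AddCommGroup Γ] [LinearOrder Γ]
    [IsOrderedAddMonoid Γ] (e : ((Fin m × Fin n) →₀ ℕ) →+ Γ)
    (he : ∀ (i k : Fin m) (j l : Fin n), i < k → j < l →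
      e (Finsupp.single (i, l) 1) + e (Finsupp.single (k, j) 1) ≤
        e (Finsupp.single (i, j) 1) + e (Finsupp.single (k, l) 1))
    (s r1 r2 c1 c2 : ℕ) (g : MvPolynomial (Fin m × Fin n) K)
    (hg : g ∈ genMinors K m n (s+1) r1 r2 c1 c2)
    (u : (Fin m × Fin n) →₀ ℕ) (hu : u ∈ g.support)
    (hlt : ∀ w ∈ g.support, w ≠ u → e w < e u) : DiagDvd (s+1) r1 r2 c1 c2 u := by
  classical
  by_contra hno
  let U : Finset (Fin m × Fin n) := u.support.filter (inRect r1 r2 c1 c2)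
  have hU : ¬ HasChain U (s+1) := by
    rintro ⟨r, c, hr, hc, h⟩
    refine hno ⟨r, c, hr, hc, fun i => ?_, fun i => ?_, fun i => ?_⟩
    · exact (Finset.mem_filter.mp (h i)).2.1
    · exact (Finset.mem_filter.mp (h i)).2.2
    · exact (Finset.mem_filter.mp (h i)).1
  obtain ⟨lev, hl1, hl2⟩ := levels s U hU
  let E : ℕ → ℕ → Γ := fun i j =>
    if h : i < m ∧ j < n then e (Finsupp.single (⟨i, h.1⟩, ⟨j, h.2⟩) 1) else 0
  have hEv : ∀ v : Fin m × Fin n, E v.1 v.2 = e (Finsupp.single v 1) := by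
    intro v
    simp only [E, dif_pos (show v.1.val < m ∧ v.2.val < n from ⟨v.1.2, v.2.2⟩)]
  have hE : ∀ i k j l, i < k → k < m → j < l → l < n → E i l + E k j ≤ E i j + E k l := by
    intro i k j l hik hk hjl hl
    have := he ⟨i, hik.trans hk⟩ ⟨k, hk⟩ ⟨j, hjl.trans hl⟩ ⟨l, hl⟩ hik hjl
    rw [← hEv, ← hEv, ← hEv, ← hEv] at this
    exact this
  let Q : ℕ → Finset (ℕ × ℕ) := fun k =>
    (U.filter (fun v => lev v = k)).image (fun v => (v.1.val, v.2.val))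
  have hpot : ∀ k, ∃ α β : ℕ → Γ, (∀ i j, i < m → α i + β j ≤ E i j) ∧
      (∀ v ∈ Q k, α v.1 + β v.2 = E v.1 v.2) := by
    intro k
    rcases Nat.eq_zero_or_pos m with hm | hm
    · refine ⟨0, 0, fun i j hi => by omega, ?_⟩
      intro v hv
      simp only [Q, Finset.mem_image] at hv
      obtain ⟨w, _, _⟩ := hv
      exact absurd w.1.2 (by omega)
    · refine potential m n hm E hE (Q k) ?_ ?_ ?_
      · intro v hv
        simp only [Q, Finset.mem_image] at hv
        obtain ⟨w, _, rfl⟩ := hv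
        exact w.1.2
      · intro v hv
        simp only [Q, Finset.mem_image] at hv
        obtain ⟨w, _, rfl⟩ := hv
        exact w.2.2
      · intro v hv w hw
        simp only [Q, Finset.mem_image, Finset.mem_filter] at hv hw
        obtain ⟨v, ⟨hv1, hv2⟩, rfl⟩ := hv
        obtain ⟨w, ⟨hw1, hw2⟩, rfl⟩ := hw
        exact hl2 v hv1 w hw1 (by omega)
  choose α β hab hQ using hpot
  let R := MvPolynomial (Fin s) K
  let H := HahnSeries Γ R
  let y : Fin m → Fin s → H := fun i k => HahnSeries.single (-(α k i)) (MvPolynomial.X k : R)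
  let z : Fin s → Fin n → H := fun k j => HahnSeries.single (-(β k j)) (1 : R)
  let M : Fin m × Fin n → H := fun v =>
    if inRect r1 r2 c1 c2 v then ∑ k, y v.1 k * z k v.2
    else HahnSeries.single (-(e (Finsupp.single v 1))) (1 : R)
  let val := HahnSeries.addVal Γ R
  have hyz : ∀ i k j, y i k * z k j =
      HahnSeries.single (-(α k i + β k j)) (MvPolynomial.X k : R) := by
    intro i k j
    exact (HahnSeries.single_mul_single ..).trans (by rw [mul_one, neg_add])
  have key : MvPolynomial.aeval M g ≠ 0 := by
    refine eval_ne_zero val ?_ e M g u hu hlt ?_ ?_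
    · intro a ha
      have : algebraMap K H a = HahnSeries.single 0 (MvPolynomial.C a : R) := rfl
      rw [this, HahnSeries.addVal_apply, HahnSeries.orderTop_single]
      · rfl
      · simpa using ha
    · intro v
      by_cases hR : inRect r1 r2 c1 c2 v
      · simp only [M, if_pos hR]
        refine val.map_le_sum ?_
        intro k _
        rw [hyz, HahnSeries.addVal_apply, HahnSeries.orderTop_single (MvPolynomial.X_ne_zero _),
          WithTop.coe_le_coe, neg_le_neg_iff, ← hEv]
        exact hab _ _ _ v.1.2
      · simp only [M, if_neg hR]
        rw [HahnSeries.addVal_apply, HahnSeries.orderTop_single one_ne_zero]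
    · intro v hv
      by_cases hR : inRect r1 r2 c1 c2 v
      · have hvU : v ∈ U := Finset.mem_filter.mpr ⟨hv, hR⟩
        simp only [M, if_pos hR]
        apply le_antisymm
        · refine val.map_le_sum ?_
          intro k _
          rw [hyz, HahnSeries.addVal_apply, HahnSeries.orderTop_single (MvPolynomial.X_ne_zero _),
            WithTop.coe_le_coe, neg_le_neg_iff, ← hEv]
          exact hab _ _ _ v.1.2
        · apply HahnSeries.addVal_le_of_coeff_ne_zero
          rw [HahnSeries.coeff_sum]
          intro h0
          have hk0 := hl1 v hvU
          have h1 := congrArg (MvPolynomial.coeff (Finsupp.single (⟨lev v, hk0⟩ : Fin s) 1)) h0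
          rw [MvPolynomial.coeff_sum, MvPolynomial.coeff_zero,
            Finset.sum_eq_single (⟨lev v, hk0⟩ : Fin s)] at h1
          · have hq := hQ (lev v) (v.1.val, v.2.val) (Finset.mem_image.mpr
              ⟨v, Finset.mem_filter.mpr ⟨hvU, rfl⟩, rfl⟩)
            simp only at hq
            rw [hyz, hq, hEv, HahnSeries.coeff_single_same, MvPolynomial.coeff_X, if_pos rfl] at h1
            exact one_ne_zero h1
          · intro k _ hk
            rw [hyz, HahnSeries.coeff_single]
            split_ifs
            · rw [MvPolynomial.coeff_X, if_neg]
              intro h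
              exact hk (Finsupp.single_left_injective one_ne_zero h)
            · simp
          · simp
      · simp only [M, if_neg hR]
        rw [HahnSeries.addVal_apply, HahnSeries.orderTop_single one_ne_zero]
  apply key
  have hle : genMinors K m n (s+1) r1 r2 c1 c2 ≤
      RingHom.ker (MvPolynomial.aeval (R := K) M : MvPolynomial (Fin m × Fin n) K →ₐ[K] H) := by
    refine Ideal.span_le.mpr ?_
    rintro _ ⟨r, c, _, _, hr, hc, rfl⟩
    rw [SetLike.mem_coe, RingHom.mem_ker, AlgHom.map_det]
    have : (MvPolynomial.aeval (R := K) M : MvPolynomial (Fin m × Fin n) K →ₐ[K] H).mapMatrix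
        (Matrix.of fun i j => MvPolynomial.X (r i, c j)) =
        (Matrix.of fun i k => y (r i) k) * (Matrix.of fun k j => z k (c j)) := by
      ext1 i j
      rw [AlgHom.mapMatrix_apply, Matrix.map_apply, Matrix.of_apply, MvPolynomial.aeval_X,
        Matrix.mul_apply]
      have hR : inRect r1 r2 c1 c2 (r i, c j) := ⟨hr i, hc j⟩
      simp only [M, if_pos hR, Matrix.of_apply]
    rw [this]
    exact det_mul_eq_zero _ _ (by simp)
  exact hle hg

end GBU

namespace GBU
open MvPolynomial

/-- The exponent of the term of a minor associated with a permutation. -/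
noncomputable def dexp {m n s : ℕ} (r : Fin s → Fin m) (c : Fin s → Fin n)
    (π : Equiv.Perm (Fin s)) : (Fin m × Fin n) →₀ ℕ :=
  ∑ i, Finsupp.single (r (π i), c i) 1

/-- Field-independent form of diagonality. -/
def Diag {m n : ℕ} (ord : MonomialOrder (Fin m × Fin n)) : Prop :=
  ∀ (s : ℕ) (r : Fin s → Fin m) (c : Fin s → Fin n), StrictMono r → StrictMono c →
    ∀ π : Equiv.Perm (Fin s), ord.toSyn (dexp r c π) ≤ ord.toSyn (dexp r c 1)

/-- A minor of the generic matrix. -/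
noncomputable def minorP (F : Type*) [CommRing F] {m n s : ℕ} (r : Fin s → Fin m)
    (c : Fin s → Fin n) : MvPolynomial (Fin m × Fin n) F :=
  Matrix.det (Matrix.of fun i j => X (r i, c j))

lemma dexp_inj {m n s : ℕ} {r : Fin s → Fin m} {c : Fin s → Fin n}
    (hr : Function.Injective r) (hc : Function.Injective c) :
    Function.Injective (dexp r c) := by
  classical
  intro π ρ h
  ext1 b
  have h1 : ∀ τ : Equiv.Perm (Fin s), ∀ a, dexp r c τ (r a, c b) = if τ b = a then 1 else 0 := by
    intro τ a
    rw [dexp, Finsupp.finsetSum_apply, Finset.sum_eq_single b]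
    · rw [Finsupp.single_apply]
      congr 1
      simp [hr.eq_iff]
    · intro i _ hi
      rw [Finsupp.single_apply, if_neg]
      intro h
      exact hi (hc (Prod.ext_iff.mp h).2)
    · simp
  have h2 := h1 π (π b)
  rw [h, h1 ρ, if_pos rfl] at h2
  by_contra hne
  rw [if_neg (Ne.symm hne)] at h2
  exact zero_ne_one h2

lemma minorP_eq (F : Type*) [CommRing F] {m n s : ℕ} (r : Fin s → Fin m) (c : Fin s → Fin n) :
    minorP F r c = ∑ π : Equiv.Perm (Fin s), monomial (dexp r c π) (((Equiv.Perm.sign π : ℤˣ) : ℤ) : F) := by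
  rw [minorP, Matrix.det_apply']
  refine Finset.sum_congr rfl fun π _ => ?_
  simp only [Matrix.of_apply]
  have : ∏ i, (X (r (π i), c i) : MvPolynomial (Fin m × Fin n) F) = monomial (dexp r c π) 1 := by
    rw [dexp, monomial_sum_one]; rfl
  rw [this, show ((((Equiv.Perm.sign π : ℤˣ) : ℤ)) : MvPolynomial (Fin m × Fin n) F)
    = C ((((Equiv.Perm.sign π : ℤˣ) : ℤ)) : F) by simp, C_mul_monomial, mul_one]

lemma coeff_minorP (F : Type*) [CommRing F] {m n s : ℕ} {r : Fin s → Fin m} {c : Fin s → Fin n}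
    (hr : Function.Injective r) (hc : Function.Injective c) (π : Equiv.Perm (Fin s)) :
    coeff (dexp r c π) (minorP F r c) = (((Equiv.Perm.sign π : ℤˣ) : ℤ) : F) := by
  classical
  rw [minorP_eq, coeff_sum, Finset.sum_eq_single π]
  · rw [coeff_monomial, if_pos rfl]
  · intro ρ _ h
    rw [coeff_monomial, if_neg]
    exact fun h' => h (dexp_inj hr hc h')
  · simp

lemma support_minorP (F : Type*) [CommRing F] {m n s : ℕ} {r : Fin s → Fin m} {c : Fin s → Fin n}
    {d} (hd : d ∈ (minorP F r c).support) : ∃ π, d = dexp r c π := by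
  classical
  rw [mem_support_iff, minorP_eq, coeff_sum] at hd
  obtain ⟨π, _, h⟩ := Finset.exists_ne_zero_of_sum_ne_zero hd
  refine ⟨π, ?_⟩
  by_contra h'
  rw [coeff_monomial, if_neg (Ne.symm h')] at h
  exact h rfl

lemma diag_of_isDiagonalOrder {K : Type*} [Field K] {m n : ℕ}
    {ord : MonomialOrder (Fin m × Fin n)} (h : IsDiagonalOrder K m n ord) : Diag ord := by
  intro s r c hr hc π
  have h1 : ord.degree (minorP K r c) = dexp r c 1 := h s r c hr hc
  rw [← h1]
  apply ord.le_degree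
  rw [mem_support_iff, coeff_minorP K hr.injective hc.injective]
  rcases Int.units_eq_one_or (Equiv.Perm.sign π) with h | h <;> simp [h]

lemma degree_minorP (F : Type*) [Field F] {m n s : ℕ} {ord : MonomialOrder (Fin m × Fin n)}
    (h : Diag ord) {r : Fin s → Fin m} {c : Fin s → Fin n} (hr : StrictMono r) (hc : StrictMono c) :
    ord.degree (minorP F r c) = dexp r c 1 := by
  apply ord.toSyn.injective
  apply le_antisymm
  · rw [MonomialOrder.degree_le_iff]
    intro d hd
    obtain ⟨π, rfl⟩ := support_minorP F hd
    exact h s r c hr hc π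
  · apply ord.le_degree
    rw [mem_support_iff, coeff_minorP F hr.injective hc.injective]
    simp

lemma monic_minorP (F : Type*) [Field F] {m n s : ℕ} {ord : MonomialOrder (Fin m × Fin n)}
    (h : Diag ord) {r : Fin s → Fin m} {c : Fin s → Fin n} (hr : StrictMono r) (hc : StrictMono c) :
    ord.Monic (minorP F r c) := by
  rw [MonomialOrder.Monic, MonomialOrder.leadingCoeff, degree_minorP F h hr hc,
    coeff_minorP F hr.injective hc.injective]
  simp

lemma exchange {m n : ℕ} {ord : MonomialOrder (Fin m × Fin n)} (h : Diag ord)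
    (i k : Fin m) (j l : Fin n) (hik : i < k) (hjl : j < l) :
      ord.toSyn (Finsupp.single (i, l) 1 + Finsupp.single (k, j) 1) ≤
        ord.toSyn (Finsupp.single (i, j) 1 + Finsupp.single (k, l) 1) := by
  have hr : StrictMono ![i, k] := by
    refine Fin.strictMono_iff_lt_succ.mpr fun x => ?_
    fin_cases x; simpa using hik
  have hc : StrictMono ![j, l] := by
    refine Fin.strictMono_iff_lt_succ.mpr fun x => ?_
    fin_cases x; simpa using hjl
  have := h 2 ![i, k] ![j, l] hr hc (Equiv.swap 0 1)
  simp only [dexp, Fin.sum_univ_two] at this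
  simpa [add_comm] using this

theorem diagDvd_degree {F : Type*} [Field F] {m n : ℕ} {ord : MonomialOrder (Fin m × Fin n)}
    (h : Diag ord) (s r1 r2 c1 c2 : ℕ) (g : MvPolynomial (Fin m × Fin n) F)
    (hg : g ∈ genMinors F m n (s+1) r1 r2 c1 c2) (hg0 : g ≠ 0) :
    DiagDvd (s+1) r1 r2 c1 c2 (ord.degree g) := by
  let Γ := Algebra.GrothendieckAddGroup ord.syn
  let e : ((Fin m × Fin n) →₀ ℕ) →+ Γ :=
    (Algebra.GrothendieckAddGroup.of (M := ord.syn)).comp ord.toSyn.toAddMonoidHom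
  have hmono : StrictMono (Algebra.GrothendieckAddGroup.of (M := ord.syn)) :=
    (AddLocalization.mkOrderEmbedding (s := (⊤ : AddSubmonoid ord.syn)) 0).strictMono
  refine diag_of_mem e ?_ s r1 r2 c1 c2 g hg _ (ord.degree_mem_support hg0) ?_
  · intro i k j l hik hjl
    rw [← map_add, ← map_add]
    exact hmono.monotone (exchange h i k j l hik hjl)
  · intro w hw hne
    apply hmono
    exact lt_of_le_of_ne (ord.le_degree hw) (fun h => hne (ord.toSyn.injective h))

lemma diagDvd_iff {m n t r1 r2 c1 c2 : ℕ} {u : (Fin m × Fin n) →₀ ℕ} :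
    DiagDvd t r1 r2 c1 c2 u ↔ ∃ (r : Fin t → Fin m) (c : Fin t → Fin n), StrictMono r ∧ StrictMono c ∧
    (∀ i, r1 ≤ (r i).val + 1 ∧ (r i).val + 1 ≤ r2) ∧
    (∀ j, c1 ≤ (c j).val + 1 ∧ (c j).val + 1 ≤ c2) ∧ dexp r c 1 ≤ u := by
  classical
  have key : ∀ (r : Fin t → Fin m) (c : Fin t → Fin n), StrictMono r →
      ((∀ i, (r i, c i) ∈ u.support) ↔ dexp r c 1 ≤ u) := by
    intro r c hr
    constructor
    · intro h v
      by_cases hv : ∃ i, (r i, c i) = v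
      · obtain ⟨i, rfl⟩ := hv
        rw [dexp, Finsupp.finsetSum_apply, Finset.sum_eq_single i]
        · have := Finsupp.mem_support_iff.mp (h i)
          simp only [Equiv.Perm.coe_one, id_eq, Finsupp.single_eq_same]
          omega
        · intro j _ hj
          rw [Finsupp.single_apply, if_neg]
          intro h
          exact hj (hr.injective (Prod.ext_iff.mp h).1)
        · simp
      · rw [dexp, Finsupp.finsetSum_apply, Finset.sum_eq_zero]
        · exact Nat.zero_le _
        · intro j _
          rw [Finsupp.single_apply, if_neg]
          exact fun h => hv ⟨j, h⟩
    · intro h i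
      rw [Finsupp.mem_support_iff]
      have h1 : Finsupp.single (r i, c i) 1 ≤ dexp r c 1 :=
        Finset.single_le_sum (f := fun i => Finsupp.single (r i, c i) 1) (fun _ _ => bot_le)
          (Finset.mem_univ i)
      have := (h1.trans h) (r i, c i)
      rw [Finsupp.single_eq_same] at this
      omega
  constructor
  · rintro ⟨r, c, hr, hc, h1, h2, h3⟩
    exact ⟨r, c, hr, hc, h1, h2, (key r c hr).1 h3⟩
  · rintro ⟨r, c, hr, hc, h1, h2, h3⟩
    exact ⟨r, c, hr, hc, h1, h2, (key r c hr).2 h3⟩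

lemma minorP_mem_aux (F : Type*) [Field F] {m n t r1 r2 c1 c2 : ℕ} (r : Fin t → Fin m)
    (c : Fin t → Fin n) (hrm : StrictMono r) (hcm : StrictMono c)
    (hr : ∀ i, r1 ≤ (r i).val + 1 ∧ (r i).val + 1 ≤ r2)
    (hc : ∀ j, c1 ≤ (c j).val + 1 ∧ (c j).val + 1 ≤ c2) :
    minorP F r c ∈ genMinors F m n t r1 r2 c1 c2 :=
  Ideal.subset_span ⟨r, c, hrm, hcm, hr, hc, rfl⟩

lemma minorP_mem (F : Type*) [Field F] {m n t r1 r2 c1 c2 : ℕ} (r : Fin t → Fin m)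
    (c : Fin t → Fin n) (hr : ∀ i, r1 ≤ (r i).val + 1 ∧ (r i).val + 1 ≤ r2)
    (hc : ∀ j, c1 ≤ (c j).val + 1 ∧ (c j).val + 1 ≤ c2) :
    minorP F r c ∈ genMinors F m n t r1 r2 c1 c2 := by
  by_cases hri : Function.Injective r
  swap
  · obtain ⟨i, j, hij, hne⟩ : ∃ i j, r i = r j ∧ i ≠ j := by
      simpa [Function.Injective] using hri
    have : minorP F r c = 0 := Matrix.det_zero_of_row_eq hne (by ext x; simp [hij])
    rw [this]; exact zero_mem _
  by_cases hci : Function.Injective c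
  swap
  · obtain ⟨i, j, hij, hne⟩ : ∃ i j, c i = c j ∧ i ≠ j := by
      simpa [Function.Injective] using hci
    have : minorP F r c = 0 := Matrix.det_zero_of_column_eq hne (by intro x; simp [hij])
    rw [this]; exact zero_mem _
  have h1 : StrictMono (r ∘ Tuple.sort r) :=
    (Tuple.monotone_sort r).strictMono_of_injective (hri.comp (Equiv.injective _))
  have h2 : StrictMono (c ∘ Tuple.sort c) :=
    (Tuple.monotone_sort c).strictMono_of_injective (hci.comp (Equiv.injective _))
  have h3 := minorP_mem_aux F _ _ h1 h2 (fun i => hr _) (fun i => hc _)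
  have h4 : minorP F (r ∘ Tuple.sort r) (c ∘ Tuple.sort c) =
      (Equiv.Perm.sign (Tuple.sort c) : ℤˣ) * ((Equiv.Perm.sign (Tuple.sort r) : ℤˣ) * minorP F r c) := by
    rw [minorP, minorP, ← Matrix.det_permute, ← Matrix.det_permute']
    rfl
  rw [h4] at h3
  rcases Int.units_eq_one_or (Equiv.Perm.sign (Tuple.sort c)) with ha | ha <;>
  rcases Int.units_eq_one_or (Equiv.Perm.sign (Tuple.sort r)) with hb | hb <;>
  simpa [ha, hb] using h3

end GBU

namespace GBU
open MvPolynomial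

/-- Rows of the distinguished (bottom-left) `s`-minor. -/
def R0 {m r2 : ℕ} (s : ℕ) (hs : s ≤ r2) (hr2 : r2 ≤ m) : Fin s → Fin m :=
  fun k => ⟨r2 - s + k, by omega⟩

/-- Columns of the distinguished (bottom-left) `s`-minor. -/
def C0 {n c1 c2 : ℕ} (s : ℕ) (hs : c1 + s ≤ c2) (hc1 : 1 ≤ c1) (hc2 : c2 ≤ n) : Fin s → Fin n :=
  fun k => ⟨c1 - 1 + k, by omega⟩

lemma strictMono_le_aux {t M : ℕ} {r : Fin t → Fin M} (hr : StrictMono r) (i j : Fin t)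
    (hij : i ≤ j) : (r i).val + (j.val - i.val) ≤ (r j).val := by
  obtain ⟨d, hd⟩ : ∃ d, j.val = i.val + d := ⟨j - i, by have : i.val ≤ j.val := hij; omega⟩
  induction d generalizing j with
  | zero => have : i = j := Fin.ext (by omega)
            subst this; simp
  | succ d ih =>
    have h1 := ih ⟨i + d, by omega⟩ (Fin.mk_le_mk.mpr (by omega)) rfl
    have h2 : r ⟨i + d, by omega⟩ < r j := hr (Fin.mk_lt_mk.mpr (by omega))
    have h3 : (r ⟨i + d, by omega⟩).val < (r j).val := h2
    simp only at h1
    omega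

lemma nzd {F : Type*} [Field F] {m n : ℕ} {ord : MonomialOrder (Fin m × Fin n)}
    (hD : Diag ord) {s r1 r2 c1 c2 : ℕ} (hs : s ≤ r2) (hr2 : r2 ≤ m) (hsc : c1 + s ≤ c2)
    (hc1 : 1 ≤ c1) (hc2 : c2 ≤ n) (h : MvPolynomial (Fin m × Fin n) F)
    (hh : minorP F (R0 s hs hr2) (C0 s hsc hc1 hc2) * h ∈ genMinors F m n (s+1) r1 r2 c1 c2) :
    h ∈ genMinors F m n (s+1) r1 r2 c1 c2 := by
  have hRm : StrictMono (R0 s hs hr2) := fun a b hab => by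
    have : a.val < b.val := hab
    simp only [R0, Fin.mk_lt_mk]; omega
  have hCm : StrictMono (C0 s hsc hc1 hc2) := fun a b hab => by
    have : a.val < b.val := hab
    simp only [C0, Fin.mk_lt_mk]; omega
  have hmon := monic_minorP F hD hRm hCm
  have hdeg := degree_minorP F hD hRm hCm
  set g0 := minorP F (R0 s hs hr2) (C0 s hsc hc1 hc2) with hg0
  induction hx : ord.toSyn (ord.degree h) using ord.wf.induction generalizing h with
  | _ x ih =>
  by_cases h0 : h = 0
  · rw [h0]; exact zero_mem _
  have hdd := diagDvd_degree hD s r1 r2 c1 c2 _ hh (mul_ne_zero hmon.ne_zero h0)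
  rw [ord.degree_mul hmon.ne_zero h0, hdeg] at hdd
  have hdd2 : DiagDvd (s+1) r1 r2 c1 c2 (ord.degree h) := by
    obtain ⟨r, c, hr, hc, h1, h2, h3⟩ := hdd
    refine ⟨r, c, hr, hc, h1, h2, fun j => ?_⟩
    have h4 := h3 j
    rw [Finsupp.mem_support_iff, Finsupp.add_apply] at h4
    rw [Finsupp.mem_support_iff]
    have : dexp (R0 s hs hr2) (C0 s hsc hc1 hc2) 1 (r j, c j) = 0 := by
      rw [dexp, Finsupp.finsetSum_apply]
      refine Finset.sum_eq_zero fun k _ => ?_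
      rw [Finsupp.single_apply, if_neg]
      intro heq
      have e1 := congrArg Fin.val (Prod.ext_iff.mp heq).1
      have e2 := congrArg Fin.val (Prod.ext_iff.mp heq).2
      simp only [R0, C0, Equiv.Perm.coe_one, id_eq] at e1 e2
      have a1 := strictMono_le_aux hr j (Fin.last s) (Fin.le_last _)
      have a2 := strictMono_le_aux hc 0 j (Fin.zero_le _)
      have b1 := (h1 (Fin.last s)).2
      have b2 := (h2 0).1
      simp only [Fin.val_last, Fin.val_zero] at a1 a2
      have := j.2
      omega
    omega
  have hnz : ord.degree h ≠ 0 := by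
    obtain ⟨r, c, _, _, _, _, h3⟩ := hdd2
    intro h0
    have := h3 0
    rw [h0] at this
    simp at this
  obtain ⟨r, c, hr, hc, h1, h2, h3⟩ := diagDvd_iff.mp hdd2
  have hmin := minorP_mem F r c h1 h2
  have hmon2 := monic_minorP F hD hr hc
  have hu : IsUnit (ord.leadingCoeff (minorP F r c)) := by
    rw [hmon2.leadingCoeff_eq_one]; exact isUnit_one
  have hlt := ord.degree_reduce_lt (f := h) hu (by rwa [degree_minorP F hD hr hc]) hnz
  have hred : h - ord.reduce hu h ∈ genMinors F m n (s+1) r1 r2 c1 c2 := by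
    rw [MonomialOrder.reduce, sub_sub_cancel]
    exact Ideal.mul_mem_left _ _ hmin
  have hi := ih _ (hx ▸ hlt) (ord.reduce hu h) (by
    have : g0 * ord.reduce hu h = g0 * h - g0 * (h - ord.reduce hu h) := by ring
    rw [this]
    exact sub_mem hh (Ideal.mul_mem_left _ _ hred)) rfl
  have := add_mem hred hi
  rwa [sub_add_cancel] at this

end GBU

namespace GBU
open MvPolynomial

/-- Determinants of matrices many of whose rows lie in an ideal. -/
lemma det_mem_pow {R ι : Type*} [CommRing R] [Fintype ι] [DecidableEq ι] (A : Matrix ι ι R)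
    (J : Ideal R) (T : Finset ι) (h : ∀ j ∈ T, ∀ i, A j i ∈ J) : A.det ∈ J ^ T.card := by
  rw [← Matrix.det_transpose, Matrix.det_apply]
  refine Ideal.sum_mem _ fun π _ => ?_
  have h1 : ∏ i, A.transpose (π i) i ∈ J ^ T.card := by
    rw [← Finset.prod_mul_prod_compl T]
    refine Ideal.mul_mem_right _ _ ?_
    rw [← Finset.prod_const]
    exact Ideal.prod_mem_prod fun i hi => h i hi _
  rcases Int.units_eq_one_or (Equiv.Perm.sign π) with h | h
  · rw [h, one_smul]; exact h1
  · rw [h, Units.neg_smul, one_smul]; exact neg_mem h1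

lemma det_zero_of_factor {R ι : Type*} [CommRing R] [Fintype ι] [DecidableEq ι] (A : Matrix ι ι R)
    (s : ℕ) (Q : Finset ι) (V : ι → Fin s → R) (U : Fin s → ι → R)
    (h : ∀ j ∈ Q, ∀ i, A j i = ∑ k, V j k * U k i) (hs : s < Q.card) : A.det = 0 := by
  classical
  let L : Matrix ι (Fin s ⊕ {l // l ∉ Q}) R := Matrix.of fun j =>
    Sum.elim (fun k => if j ∈ Q then V j k else 0) (fun l => if j = l.1 then 1 else 0)
  let M : Matrix (Fin s ⊕ {l // l ∉ Q}) ι R := Matrix.of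
    (Sum.elim (fun k i => U k i) (fun l i => A l.1 i))
  have hA : A = L * M := by
    ext j i
    rw [Matrix.mul_apply, Fintype.sum_sum_type]
    simp only [L, M, Matrix.of_apply, Sum.elim_inl, Sum.elim_inr]
    by_cases hj : j ∈ Q
    · simp only [hj, if_true]
      rw [h j hj, left_eq_add]
      refine Finset.sum_eq_zero fun l _ => ?_
      rw [if_neg, zero_mul]
      rintro rfl
      exact l.2 hj
    · simp only [hj, if_false, zero_mul, Finset.sum_const_zero, zero_add]
      rw [Finset.sum_eq_single ⟨j, hj⟩]
      · simp
      · intro l _ hl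
        rw [if_neg, zero_mul]
        rintro rfl
        exact hl rfl
      · simp
  rw [hA]
  apply det_mul_eq_zero
  rw [Fintype.card_sum, Fintype.card_fin]
  have : Fintype.card {l // l ∉ Q} = Fintype.card ι - Q.card := by
    rw [Fintype.card_subtype_compl, Fintype.card_coe]
  have h2 := Finset.card_le_univ Q
  omega

lemma pow_mul_det_mem {R ι : Type*} [CommRing R] [Fintype ι] [DecidableEq ι] (A : Matrix ι ι R)
    (s : ℕ) (T : Finset ι) (g : R) (V : ι → Fin s → R) (U : Fin s → ι → R) (J : Ideal R)
    (h : ∀ j ∈ T, ∀ i, g * A j i - ∑ k, V j k * U k i ∈ J) :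
    g ^ T.card * A.det ∈ J ^ (T.card - s) := by
  classical
  let P : ι → ι → R := fun j i => ∑ k, V j k * U k i
  let M : ι → ι → R := fun j i => if j ∈ T then g * A j i - P j i else A j i
  have h1 : g ^ T.card * A.det = Matrix.detRowAlternating (T.piecewise (P + M) M) := by
    have : (T.piecewise (P + M) M : ι → ι → R) =
        Matrix.diagonal (fun j => if j ∈ T then g else 1) * A := by
      ext j i
      rw [Matrix.diagonal_mul]
      by_cases hj : j ∈ T
      · rw [Finset.piecewise_eq_of_mem _ _ _ hj]
        simp [M, hj]
      · rw [Finset.piecewise_eq_of_notMem _ _ _ hj]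
        simp [M, hj]
    rw [this]
    show _ = Matrix.det _
    rw [Matrix.det_mul, Matrix.det_diagonal]
    congr 1
    rw [Finset.prod_ite_mem, Finset.univ_inter, Finset.prod_const]
  rw [h1]
  have h2 := MultilinearMap.map_piecewise_add
    (Matrix.detRowAlternating (R := R) (n := ι)).toMultilinearMap P M T
  simp only [AlternatingMap.coe_multilinearMap] at h2
  rw [h2]
  refine Ideal.sum_mem _ fun Q hQ => ?_
  rw [Finset.mem_powerset] at hQ
  show Matrix.det _ ∈ _
  by_cases hs : s < Q.card
  · have hz : Matrix.det (Matrix.of (Q.piecewise P M)) = 0 := by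
      refine det_zero_of_factor _ s Q V U ?_ hs
      intro j hj i
      rw [Matrix.of_apply, Finset.piecewise_eq_of_mem _ _ _ hj]
    exact hz ▸ zero_mem _
  · refine Ideal.pow_le_pow_right (n := (T \ Q).card) ?_ (det_mem_pow _ J (T \ Q) ?_)
    · rw [Finset.card_sdiff_of_subset hQ]; omega
    · intro j hj i
      rw [Finset.mem_sdiff] at hj
      rw [Finset.piecewise_eq_of_notMem _ _ _ hj.2]
      simp only [M, if_pos hj.1]
      exact h j hj.1 i

/-- Determinant of a bordered matrix. -/
lemma det_bordered {R : Type*} [CommRing R] [IsDomain R] {s : ℕ} (A : Matrix (Fin s) (Fin s) R)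
    (hA : A.det ≠ 0) (b : Matrix (Fin s) (Fin 1) R) (c : Matrix (Fin 1) (Fin s) R)
    (d : Matrix (Fin 1) (Fin 1) R) :
    (Matrix.fromBlocks A b c d).det = A.det * d 0 0 - (c * A.adjugate * b) 0 0 := by
  have h := congrArg Matrix.det (Matrix.fromBlocks_multiply A b c d A.adjugate
    (- (A.adjugate * b)) 0 (A.det • (1 : Matrix (Fin 1) (Fin 1) R)))
  have e1 : A * A.adjugate + b * (0 : Matrix (Fin 1) (Fin s) R) = A.det • 1 := by
    rw [Matrix.mul_adjugate, Matrix.mul_zero, add_zero]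
  have e2 : A * -(A.adjugate * b) + b * (A.det • (1 : Matrix (Fin 1) (Fin 1) R)) = 0 := by
    rw [Matrix.mul_neg, ← Matrix.mul_assoc, Matrix.mul_adjugate]
    ext i j
    simp
  rw [e1, e2, Matrix.det_mul, Matrix.det_fromBlocks_zero₂₁, Matrix.det_fromBlocks_zero₁₂,
    Matrix.det_smul, Matrix.det_one, Fintype.card_fin, mul_one, Matrix.det_smul,
    Matrix.det_one, Fintype.card_fin, pow_one, mul_one, Matrix.det_fin_one] at h
  have h3 : A.det * A.adjugate.det = A.det ^ s := by
    rw [← Matrix.det_mul, Matrix.mul_adjugate, Matrix.det_smul, Matrix.det_one, Fintype.card_fin,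
      mul_one]
  rw [mul_comm A.adjugate.det, h3, mul_comm] at h
  have h4 := mul_left_cancel₀ (pow_ne_zero _ hA) h
  rw [h4]
  simp [Matrix.add_apply, Matrix.mul_neg, Matrix.mul_assoc]
  ring

end GBU

namespace GBU
open MvPolynomial

/-- The data of a band of rows or columns together with the minor size `s + 1`. -/
structure Band (m n : ℕ) where
  s : ℕ
  r1 : ℕ
  r2 : ℕ
  c1 : ℕ
  c2 : ℕ
  hr1 : 1 ≤ r1
  hr : r1 + s ≤ r2
  hr2 : r2 ≤ m
  hc1 : 1 ≤ c1
  hc : c1 + s ≤ c2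
  hc2 : c2 ≤ n
  full : (r1 = 1 ∧ r2 = m) ∨ (c1 = 1 ∧ c2 = n)

namespace Band

variable {m n : ℕ} (B : Band m n) (F : Type*) [Field F]

/-- The ideal of minors of a band. -/
noncomputable def I : Ideal (MvPolynomial (Fin m × Fin n) F) :=
  genMinors F m n (B.s + 1) B.r1 B.r2 B.c1 B.c2

/-- rows of the distinguished minor -/
def rows : Fin B.s → Fin m := R0 B.s (le_trans (Nat.le_add_left _ _) B.hr) B.hr2

/-- columns of the distinguished minor -/
def cols : Fin B.s → Fin n := C0 B.s B.hc B.hc1 B.hc2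

/-- the distinguished minor -/
noncomputable def g0 : MvPolynomial (Fin m × Fin n) F := minorP F B.rows B.cols

/-- the bordered minors -/
noncomputable def E (v : Fin m × Fin n) : MvPolynomial (Fin m × Fin n) F :=
  minorP F (Fin.snoc B.rows v.1 : Fin (B.s+1) → Fin m) (Fin.snoc B.cols v.2 : Fin (B.s+1) → Fin n)

/-- the sub-rectangle indexing the nonzero bordered minors -/
def W : Finset (Fin m × Fin n) := Finset.univ.filter fun v =>
  (B.r1 ≤ v.1.val + 1 ∧ v.1.val + 1 + B.s ≤ B.r2) ∧ (B.c1 + B.s ≤ v.2.val + 1 ∧ v.2.val + 1 ≤ B.c2)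

/-- ideal generated by the bordered minors -/
noncomputable def J : Ideal (MvPolynomial (Fin m × Fin n) F) :=
  Ideal.span (B.E F '' (B.W : Set (Fin m × Fin n)))

lemma rows_mem (k) : B.r1 ≤ (B.rows k).val + 1 ∧ (B.rows k).val + 1 ≤ B.r2 := by
  have := B.hr
  have := k.2
  simp only [rows, R0]
  omega

lemma cols_mem (k) : B.c1 ≤ (B.cols k).val + 1 ∧ (B.cols k).val + 1 ≤ B.c2 := by
  have := B.hc
  have := B.hc1
  have := k.2
  simp only [cols, C0]
  omega

lemma rows_mono : StrictMono B.rows := fun a b hab => by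
    have : a.val < b.val := hab
    simp only [rows, R0, Fin.mk_lt_mk]; omega

lemma cols_mono : StrictMono B.cols := fun a b hab => by
    have : a.val < b.val := hab
    simp only [cols, C0, Fin.mk_lt_mk]; omega

lemma g0_ne_zero : B.g0 F ≠ 0 := by
  intro h
  have h1 := coeff_minorP F B.rows_mono.injective B.cols_mono.injective 1
  rw [g0] at h
  rw [h] at h1
  simp at h1

lemma E_mem_I (v : Fin m × Fin n) (hv : inRect B.r1 B.r2 B.c1 B.c2 v) : B.E F v ∈ B.I F := by
  apply minorP_mem
  · intro i
    refine Fin.lastCases ?_ (fun i => ?_) i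
    · simpa using hv.1
    · simpa using B.rows_mem i
  · intro i
    refine Fin.lastCases ?_ (fun i => ?_) i
    · simpa using hv.2
    · simpa using B.cols_mem i

lemma J_le_I : B.J F ≤ B.I F := by
  refine Ideal.span_le.mpr ?_
  rintro _ ⟨v, hv, rfl⟩
  apply B.E_mem_I F v
  simp only [W, Finset.coe_filter, Finset.mem_univ, true_and, Set.mem_ofPred_eq] at hv
  refine ⟨⟨hv.1.1, by omega⟩, ⟨by omega, hv.2.2⟩⟩

lemma E_mem_J (v : Fin m × Fin n) (hv : inRect B.r1 B.r2 B.c1 B.c2 v) : B.E F v ∈ B.J F := by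
  have hr := B.hr
  have hc := B.hc
  have hc1 := B.hc1
  obtain ⟨⟨h1, h2⟩, h3, h4⟩ := hv
  by_cases hR : v.1.val + 1 + B.s ≤ B.r2
  · by_cases hC : B.c1 + B.s ≤ v.2.val + 1
    · apply Ideal.subset_span
      refine ⟨v, ?_, rfl⟩
      simp only [W, Finset.coe_filter, Finset.mem_univ, true_and, Set.mem_ofPred_eq]
      exact ⟨⟨h1, hR⟩, hC, h4⟩
    · have : B.E F v = 0 := by
        let k : Fin B.s := ⟨v.2.val + 1 - B.c1, by omega⟩
        refine Matrix.det_zero_of_column_eq (i := k.castSucc) (j := Fin.last _)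
          (Fin.castSucc_lt_last k).ne ?_
        intro x
        have : B.cols k = v.2 := by
          ext; simp only [cols, C0, k]; omega
        simp only [Matrix.of_apply, Fin.snoc_castSucc, Fin.snoc_last, this]
      rw [this]; exact zero_mem _
  · have : B.E F v = 0 := by
      let k : Fin B.s := ⟨v.1.val + B.s - B.r2, by omega⟩
      refine Matrix.det_zero_of_row_eq (i := k.castSucc) (j := Fin.last _)
        (Fin.castSucc_lt_last k).ne ?_
      ext1 x
      have : B.rows k = v.1 := by
        ext; simp only [rows, R0, k]; omega
      simp only [Matrix.of_apply, Fin.snoc_castSucc, Fin.snoc_last, this]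
    rw [this]; exact zero_mem _

/-- the matrix of the distinguished minor -/
noncomputable def A0 : Matrix (Fin B.s) (Fin B.s) (MvPolynomial (Fin m × Fin n) F) :=
  Matrix.of fun i j => X (B.rows i, B.cols j)

/-- Coefficients. -/
noncomputable def V (k : Fin B.s) (j : Fin n) : MvPolynomial (Fin m × Fin n) F :=
  ∑ l, (B.A0 F).adjugate k l * X (B.rows l, j)

lemma E_eq (i : Fin m) (j : Fin n) :
    B.E F (i, j) = B.g0 F * X (i, j) - ∑ k, X (i, B.cols k) * B.V F k j := by
  have h := det_bordered (B.A0 F) (B.g0_ne_zero F) (Matrix.of fun l _ => X (B.rows l, j))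
    (Matrix.of fun _ l => X (i, B.cols l)) (Matrix.of fun _ _ => X (i, j))
  have h2 : B.E F (i, j) = (Matrix.fromBlocks (B.A0 F) (Matrix.of fun l _ => X (B.rows l, j))
    (Matrix.of fun _ l => X (i, B.cols l)) (Matrix.of fun (_ _ : Fin 1) => X (i, j))).det := by
    rw [E, minorP, ← Matrix.det_submatrix_equiv_self (finSumFinEquiv (m := B.s) (n := 1))]
    congr 1
    ext1 x y
    have e1 : ∀ k : Fin B.s, Fin.castAdd 1 k = k.castSucc := fun k => rfl
    have e2 : ∀ k : Fin 1, Fin.natAdd B.s k = Fin.last B.s := fun k => by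
      ext; simp
    rcases x with x | x <;> rcases y with y | y <;>
    simp [A0, Matrix.fromBlocks, e1, e2]
  rw [h2, h]
  congr 1
  rw [Matrix.mul_assoc, Matrix.mul_apply]
  refine Finset.sum_congr rfl fun k _ => ?_
  rw [Matrix.mul_apply]
  rfl

lemma nzd {ord : MonomialOrder (Fin m × Fin n)} (hD : Diag ord) (h : MvPolynomial (Fin m × Fin n) F)
    (hh : B.g0 F * h ∈ B.I F) : h ∈ B.I F :=
  GBU.nzd hD _ _ _ _ _ h hh

lemma nzd_pow {ord : MonomialOrder (Fin m × Fin n)} (hD : Diag ord) (N : ℕ)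
    (h : MvPolynomial (Fin m × Fin n) F)
    (hh : B.g0 F ^ N * h ∈ B.I F) : h ∈ B.I F := by
  induction N with
  | zero => simpa using hh
  | succ N ih =>
    apply ih
    apply B.nzd F hD
    rwa [← mul_assoc, ← pow_succ']

open Classical in
lemma minor_mem_pow {t : ℕ} (r : Fin t → Fin m) (c : Fin t → Fin n) :
    B.g0 F ^ (Finset.univ.filter fun k => inRect B.r1 B.r2 B.c1 B.c2 (r k, c k)).card *
      minorP F r c ∈
    B.J F ^ ((Finset.univ.filter fun k => inRect B.r1 B.r2 B.c1 B.c2 (r k, c k)).card - B.s) := by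
  rcases B.full with ⟨h1, h2⟩ | ⟨h1, h2⟩
  · rw [minorP, ← Matrix.det_transpose]
    refine pow_mul_det_mem _ B.s _ (B.g0 F) (fun j k => B.V F k (c j))
      (fun k i => X (r i, B.cols k)) _ ?_
    intro j hj i
    rw [Finset.mem_filter] at hj
    have := B.E_mem_J F (r i, c j) ⟨by have := (r i).2; simp only; omega, hj.2.2⟩
    rw [E_eq] at this
    rw [Matrix.transpose_apply, Matrix.of_apply]
    convert this using 3
    exact mul_comm _ _
  · rw [minorP]
    refine pow_mul_det_mem _ B.s _ (B.g0 F) (fun j k => X (r j, B.cols k))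
      (fun k i => B.V F k (c i)) _ ?_
    intro j hj i
    rw [Finset.mem_filter] at hj
    have := B.E_mem_J F (r j, c i) ⟨hj.2.1, by have := (c i).2; simp only; omega⟩
    rw [E_eq] at this
    rwa [Matrix.of_apply]

lemma pow_mul_mem_J (h : MvPolynomial (Fin m × Fin n) F) (hh : h ∈ B.I F) :
    B.g0 F ^ (B.s + 1) * h ∈ B.J F := by
  classical
  have : B.I F ≤ Submodule.comap (LinearMap.mulLeft (MvPolynomial (Fin m × Fin n) F)
      (B.g0 F ^ (B.s+1))) (B.J F) := by
    refine Submodule.span_le.mpr ?_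
    rintro _ ⟨r, c, hr, hc, h1, h2, rfl⟩
    have h3 := B.minor_mem_pow F r c
    have h4 : (Finset.univ.filter fun k => inRect B.r1 B.r2 B.c1 B.c2 (r k, c k)) = Finset.univ := by
      refine Finset.filter_true_of_mem fun k _ => ⟨h1 k, h2 k⟩
    rw [h4, Finset.card_univ, Fintype.card_fin, Nat.add_sub_cancel_left, pow_one] at h3
    exact h3
  exact this hh

end Band
end GBU

namespace GBU
open MvPolynomial

/-- first row of a diagonal line -/
def li (m ℓ : ℕ) : ℕ := m - 1 - ℓ
/-- first column of a diagonal line -/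
def lj (m ℓ : ℕ) : ℕ := ℓ - (m - 1)
/-- length of a diagonal line -/
def lsize (m n ℓ : ℕ) : ℕ := min (m - li m ℓ) (n - lj m ℓ)

/-- rows of the line -/
def lineR (m n ℓ : ℕ) : Fin (lsize m n ℓ) → Fin m := fun k => ⟨li m ℓ + k, by
  have := k.2
  simp only [lsize] at this
  omega⟩
/-- columns of the line -/
def lineC (m n ℓ : ℕ) : Fin (lsize m n ℓ) → Fin n := fun k => ⟨lj m ℓ + k, by
  have := k.2
  simp only [lsize] at this
  omega⟩

lemma lineR_mono (m n ℓ : ℕ) : StrictMono (lineR m n ℓ) := fun a b hab => by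
    have : a.val < b.val := hab
    simp only [lineR, Fin.mk_lt_mk]; omega

lemma lineC_mono (m n ℓ : ℕ) : StrictMono (lineC m n ℓ) := fun a b hab => by
    have : a.val < b.val := hab
    simp only [lineC, Fin.mk_lt_mk]; omega

/-- all cells, by lines -/
def lineMap (m n : ℕ) (x : Σ ℓ : Fin (m + n - 1), Fin (lsize m n ℓ)) : Fin m × Fin n :=
  (lineR m n x.1 x.2, lineC m n x.1 x.2)

lemma lineMap_bij (m n : ℕ) : Function.Bijective (lineMap m n) := by
  constructor
  · rintro ⟨ℓ, k⟩ ⟨ℓ', k'⟩ h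
    have h1 := congrArg Fin.val (Prod.ext_iff.mp h).1
    have h2 := congrArg Fin.val (Prod.ext_iff.mp h).2
    have hk := k.2
    have hk' := k'.2
    simp only [lsize] at hk hk'
    simp only [lineMap, lineR, lineC, li, lj] at h1 h2 hk hk'
    have hℓ : ℓ = ℓ' := by ext; omega
    subst hℓ
    have : k = k' := by ext; omega
    rw [this]
  · rintro ⟨i, j⟩
    have hi := i.2
    have hj := j.2
    refine ⟨⟨⟨j + (m - 1) - i, by omega⟩, ⟨min i j, ?_⟩⟩, ?_⟩
    · simp only [lsize, li, lj]; omega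
    · ext
      · simp only [lineMap, lineR, li]; omega
      · simp only [lineMap, lineC, lj]; omega

lemma sum_lines {M : Type*} [AddCommMonoid M] (m n : ℕ) (φ : Fin m × Fin n → M) :
    ∑ ℓ : Fin (m + n - 1), ∑ k, φ (lineR m n ℓ k, lineC m n ℓ k) = ∑ v, φ v := by
  rw [← (lineMap_bij m n).sum_comp, Fintype.sum_sigma]
  rfl

/-- the product of the diagonal minors -/
noncomputable def fP (F : Type*) [Field F] (m n : ℕ) : MvPolynomial (Fin m × Fin n) F :=
  ∏ ℓ : Fin (m + n - 1), minorP F (lineR m n ℓ) (lineC m n ℓ)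

/-- the all ones exponent -/
noncomputable def ones (m n : ℕ) : (Fin m × Fin n) →₀ ℕ := ∑ v, Finsupp.single v 1

lemma ones_apply (m n : ℕ) (v) : ones m n v = 1 := by
  classical
  rw [ones, Finsupp.finsetSum_apply]
  simp [Finsupp.single_apply]

lemma monic_fP (F : Type*) [Field F] {m n : ℕ} {ord : MonomialOrder (Fin m × Fin n)}
    (hD : Diag ord) : ord.Monic (fP F m n) :=
  MonomialOrder.Monic.prod fun ℓ _ => monic_minorP F hD (lineR_mono m n ℓ) (lineC_mono m n ℓ)

lemma degree_fP (F : Type*) [Field F] {m n : ℕ} {ord : MonomialOrder (Fin m × Fin n)}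
    (hD : Diag ord) : ord.degree (fP F m n) = ones m n := by
  rw [fP, MonomialOrder.degree_prod]
  · rw [ones, ← sum_lines]
    refine Finset.sum_congr rfl fun ℓ _ => ?_
    rw [degree_minorP F hD (lineR_mono m n ℓ) (lineC_mono m n ℓ), dexp]
    rfl
  · intro ℓ _
    exact (monic_minorP F hD (lineR_mono m n ℓ) (lineC_mono m n ℓ)).ne_zero

lemma card_fin_filter {N : ℕ} (P : Fin N → Prop) [DecidablePred P] (a b : ℕ) (hb : b ≤ N)
    (h : ∀ k, P k ↔ a ≤ k.val ∧ k.val < b) : (Finset.univ.filter P).card = b - a := by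
  rw [← Nat.card_Ico, ← Finset.card_map Fin.valEmbedding]
  congr 1
  ext x
  simp only [Finset.mem_map, Finset.mem_filter, Finset.mem_univ, true_and, Fin.valEmbedding_apply,
    Finset.mem_Ico]
  constructor
  · rintro ⟨k, hk, rfl⟩
    exact (h k).1 hk
  · intro hx
    exact ⟨⟨x, by omega⟩, (h _).2 hx, rfl⟩

namespace Band
variable {m n : ℕ} (B : Band m n) (F : Type*) [Field F]

open Classical in
/-- number of cells of a line in the band -/
noncomputable def q (ℓ : ℕ) : ℕ :=
  (Finset.univ.filter fun k => inRect B.r1 B.r2 B.c1 B.c2 (lineR m n ℓ k, lineC m n ℓ k)).card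

lemma card_W_le : B.W.card ≤ ∑ ℓ : Fin (m + n - 1), (B.q ℓ - B.s) := by
  classical
  let P : Fin m × Fin n → Prop := fun v =>
    (B.r1 ≤ v.1.val + 1 ∧ v.1.val + 1 + B.s ≤ B.r2) ∧ (B.c1 ≤ v.2.val + 1 ∧ v.2.val + 1 + B.s ≤ B.c2)
  have h1 : B.W.card ≤ (Finset.univ.filter P).card := by
    refine Finset.card_le_card_of_injOn
      (fun v => (v.1, ⟨v.2.val - B.s, lt_of_le_of_lt (Nat.sub_le _ _) v.2.2⟩)) ?_ ?_
    · intro v hv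
      simp only [W, Finset.coe_filter, Finset.mem_univ, true_and, Set.mem_ofPred_eq] at hv
      have := B.hc1
      simp only [P, Finset.coe_filter, Finset.mem_univ, true_and, Set.mem_ofPred_eq]
      omega
    · intro v hv w hw h
      simp only [W, Finset.coe_filter, Finset.mem_univ, true_and, Set.mem_ofPred_eq] at hv hw
      have := B.hc1
      simp only [Prod.mk.injEq, Fin.mk.injEq] at h
      refine Prod.ext h.1 (Fin.ext ?_)
      omega
  refine h1.trans (le_of_eq ?_)
  rw [Finset.card_filter, ← sum_lines]
  refine Finset.sum_congr rfl fun ℓ _ => ?_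
  rw [← Finset.card_filter]
  have hr1 := B.hr1
  have hc1 := B.hc1
  have hr2 := B.hr2
  have hc2 := B.hc2
  rw [q, card_fin_filter _ (max (B.r1 - 1 - li m ℓ) (B.c1 - 1 - lj m ℓ))
    (min (B.r2 - B.s - li m ℓ) (B.c2 - B.s - lj m ℓ)),
    card_fin_filter _ (max (B.r1 - 1 - li m ℓ) (B.c1 - 1 - lj m ℓ))
    (min (B.r2 - li m ℓ) (B.c2 - lj m ℓ))]
  · omega
  · simp only [lsize]; omega
  · intro k
    simp only [inRect, lineR, lineC]; omega
  · simp only [lsize]; omega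
  · intro k
    simp only [lineR, lineC]; omega

lemma exists_pow_mul_f : ∃ N, B.g0 F ^ N * fP F m n ∈ B.J F ^ B.W.card := by
  refine ⟨∑ ℓ : Fin (m + n - 1), B.q ℓ, ?_⟩
  refine Ideal.pow_le_pow_right B.card_W_le ?_
  rw [← Finset.prod_pow_eq_pow_sum, ← Finset.prod_pow_eq_pow_sum, fP, ← Finset.prod_mul_distrib]
  refine Ideal.prod_mem_prod fun ℓ _ => ?_
  exact B.minor_mem_pow F _ _

end Band
end GBU

namespace GBU
open MvPolynomial

lemma sup_pow_le {R : Type*} [CommRing R] (I J : Ideal R) (a b : ℕ) :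
    (I ⊔ J) ^ (a + b + 1) ≤ I ^ (a + 1) ⊔ J ^ (b + 1) := by
  rw [← Ideal.add_eq_sup, add_pow, Ideal.sum_eq_sup]
  refine Finset.sup_le fun i hi => ?_
  refine Ideal.mul_le_left.trans ?_
  by_cases h : a + 1 ≤ i
  · refine le_trans ?_ (le_sup_left (a := I ^ (a + 1)) (b := J ^ (b + 1)))
    exact Ideal.mul_le_left.trans (Ideal.pow_le_pow_right h)
  · refine le_trans ?_ (le_sup_right (a := I ^ (a + 1)) (b := J ^ (b + 1)))
    have h2 : b + 1 ≤ a + b + 1 - i := by omega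
    exact Ideal.mul_le_right.trans (Ideal.pow_le_pow_right h2)

lemma span_pow_le {R α : Type*} [CommRing R] [DecidableEq α] (E : α → R) (p : ℕ) (hp : 0 < p)
    (W : Finset α) : (Ideal.span (E '' (W : Set α))) ^ (W.card * (p - 1) + 1) ≤
      Ideal.span ((fun v => E v ^ p) '' (W : Set α)) := by
  induction W using Finset.induction_on with
  | empty => simp
  | insert a W ha ih =>
    rw [Finset.card_insert_of_notMem ha, Finset.coe_insert, Set.image_insert_eq,
      Set.image_insert_eq, Ideal.span_insert, Ideal.span_insert]
    have : (W.card + 1) * (p - 1) + 1 = (p - 1) + W.card * (p - 1) + 1 := by ring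
    rw [this]
    refine (sup_pow_le _ _ _ _).trans ?_
    rw [Nat.sub_add_cancel hp, Ideal.span_singleton_pow]
    exact sup_le_sup_left ih _

section
variable {F : Type*} [Field F] {m n : ℕ} (p : ℕ)

/-- The exponent `p e + (p-1)(1,...,1)`. -/
noncomputable def up (e : (Fin m × Fin n) →₀ ℕ) : (Fin m × Fin n) →₀ ℕ :=
  p • e + (p - 1) • ones m n

lemma up_apply (e : (Fin m × Fin n) →₀ ℕ) (v) : up p e v = p * e v + (p - 1) := by
  simp [up, ones_apply]

lemma up_inj (hp : 0 < p) : Function.Injective (up p (m := m) (n := n)) := by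
  intro a b h
  ext v
  have := DFunLike.congr_fun h v
  rw [up_apply, up_apply] at this
  have h2 : p * a v = p * b v := by omega
  exact Nat.eq_of_mul_eq_mul_left hp h2

open Classical in
/-- The Frobenius trace. -/
noncomputable def Tr (h : MvPolynomial (Fin m × Fin n) F) : MvPolynomial (Fin m × Fin n) F :=
  if hp : 0 < p then
    ∑ e ∈ h.support.preimage (up p) (up_inj p hp).injOn, monomial e (coeff (up p e) h)
  else 0

lemma coeff_Tr (hp : 0 < p) (h : MvPolynomial (Fin m × Fin n) F) (e) :
    coeff e (Tr p h) = coeff (up p e) h := by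
  classical
  rw [Tr, dif_pos hp, coeff_sum]
  simp only [coeff_monomial]
  rw [Finset.sum_ite_eq']
  split_ifs with h1
  · rfl
  · rw [Finset.mem_preimage, mem_support_iff, not_not] at h1
    exact h1.symm

lemma Tr_add (hp : 0 < p) (a b : MvPolynomial (Fin m × Fin n) F) :
    Tr p (a + b) = Tr p a + Tr p b := by
  ext e
  simp [coeff_Tr p hp]

lemma Tr_zero (hp : 0 < p) : Tr p (0 : MvPolynomial (Fin m × Fin n) F) = 0 := by
  ext e
  simp [coeff_Tr p hp]

lemma Tr_expand_mul (hp : 0 < p) (u v : MvPolynomial (Fin m × Fin n) F) :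
    Tr p (expand p u * v) = u * Tr p v := by
  classical
  induction u using MvPolynomial.induction_on' with
  | add f g hf hg => rw [map_add, add_mul, Tr_add p hp, hf, hg, add_mul]
  | monomial a b =>
    ext e
    rw [coeff_Tr p hp, expand_monomial, coeff_monomial_mul', coeff_monomial_mul', coeff_Tr p hp]
    have hiff : p • a ≤ up p e ↔ a ≤ e := by
      constructor
      · intro h v
        have := h v
        rw [up_apply, Finsupp.smul_apply, smul_eq_mul] at this
        have h2 : p * a v < p * (e v + 1) := by rw [mul_add, mul_one]; omega
        exact Nat.lt_succ_iff.mp (Nat.lt_of_mul_lt_mul_left h2)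
      · intro h v
        rw [up_apply, Finsupp.smul_apply, smul_eq_mul]
        exact (Nat.mul_le_mul_left p (h v)).trans (Nat.le_add_right _ _)
    by_cases h : a ≤ e
    · rw [if_pos h, if_pos (hiff.2 h)]
      congr 2
      ext v
      rw [Finsupp.tsub_apply, up_apply, up_apply, Finsupp.smul_apply, smul_eq_mul,
        Finsupp.tsub_apply, Nat.mul_sub]
      have := Nat.mul_le_mul_left p (h v)
      omega
    · rw [if_neg h, if_neg (fun h' => h (hiff.1 h'))]

lemma minorP_pow [Fact p.Prime] [CharP F p] {t : ℕ} (r : Fin t → Fin m) (c : Fin t → Fin n) :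
    minorP F r c ^ p = expand p (minorP F r c) := by
  have : ExpChar F p := ExpChar.prime Fact.out
  rw [← map_frobenius_expand, map_expand]
  congr 1
  rw [minorP, RingHom.map_det]
  congr 1
  ext1 i j
  simp

lemma Tr_minor_pow_mul [Fact p.Prime] [CharP F p] {t : ℕ} (r : Fin t → Fin m) (c : Fin t → Fin n)
    (k : ℕ) (v : MvPolynomial (Fin m × Fin n) F) :
    Tr p (minorP F r c ^ (p * k) * v) = minorP F r c ^ k * Tr p v := by
  rw [pow_mul, minorP_pow, ← map_pow, Tr_expand_mul p (Fact.out : p.Prime).pos]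

/-- The Frobenius near-splitting. -/
noncomputable def phi (h : MvPolynomial (Fin m × Fin n) F) : MvPolynomial (Fin m × Fin n) F :=
  Tr p (fP F m n ^ (p - 1) * h)

lemma phi_add (hp : 0 < p) (a b : MvPolynomial (Fin m × Fin n) F) :
    phi p (a + b) = phi p a + phi p b := by
  rw [phi, mul_add, Tr_add p hp, phi, phi]

lemma phi_zero (hp : 0 < p) : phi p (0 : MvPolynomial (Fin m × Fin n) F) = 0 := by
  rw [phi, mul_zero, Tr_zero p hp]

lemma phi_degree {ord : MonomialOrder (Fin m × Fin n)} (hD : Diag ord) (hp : 0 < p)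
    (h : MvPolynomial (Fin m × Fin n) F) (h0 : h ≠ 0) (u) (hu : ord.degree h = p • u) :
    phi p h ≠ 0 ∧ ord.degree (phi p h) = u := by
  have hf0 := (monic_fP F hD).ne_zero
  have hdeg : ord.degree (fP F m n ^ (p - 1) * h) = up p u := by
    rw [ord.degree_mul (pow_ne_zero _ hf0) h0, ord.degree_pow, degree_fP F hD, hu, up, add_comm]
  have hu2 : coeff u (phi p h) ≠ 0 := by
    rw [phi, coeff_Tr p hp, ← hdeg, ord.coeff_degree_ne_zero_iff]
    exact mul_ne_zero (pow_ne_zero _ hf0) h0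
  refine ⟨fun h => hu2 (by rw [h, coeff_zero]), ?_⟩
  apply ord.toSyn.injective
  apply le_antisymm
  · rw [MonomialOrder.degree_le_iff]
    intro e he
    rw [mem_support_iff, phi, coeff_Tr p hp] at he
    have h1 := ord.le_degree (mem_support_iff.mpr he)
    rw [hdeg, up, up, map_add, map_add, add_le_add_iff_right, map_nsmul, map_nsmul] at h1
    by_contra hlt
    rw [not_le] at hlt
    exact absurd h1 (not_le.mpr (nsmul_lt_nsmul_right hp.ne' hlt))
  · exact ord.le_degree (mem_support_iff.mpr hu2)

lemma phi_mem {ord : MonomialOrder (Fin m × Fin n)} (hD : Diag ord) [Fact p.Prime] [CharP F p]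
    (B : Band m n) (h : MvPolynomial (Fin m × Fin n) F) (hh : h ∈ B.I F) : phi p h ∈ B.I F := by
  classical
  have hp : 0 < p := (Fact.out : p.Prime).pos
  obtain ⟨N, hN⟩ := B.exists_pow_mul_f F
  have hM := B.pow_mul_mem_J F h hh
  have h1 : B.g0 F ^ (p * (N + (B.s + 1))) * (fP F m n ^ (p - 1) * h) ∈
      Ideal.span ((fun v => B.E F v ^ p) '' (B.W : Set _)) := by
    apply span_pow_le (B.E F) p hp B.W
    have h2 := Ideal.mul_mem_mul (Ideal.pow_mem_pow hN (p - 1)) hM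
    rw [← pow_mul, ← pow_succ] at h2
    obtain ⟨q, hq⟩ : ∃ q, p * (N + (B.s + 1)) = q + (N * (p - 1) + (B.s + 1)) := by
      refine Nat.exists_eq_add_of_le' ?_
      have e1 : N * (p - 1) ≤ p * N := by
        rw [mul_comm p]; exact Nat.mul_le_mul_left _ (Nat.sub_le _ _)
      have e2 : B.s + 1 ≤ p * (B.s + 1) := Nat.le_mul_of_pos_left _ hp
      rw [mul_add]
      omega
    have h3 := Ideal.mul_mem_left _ (B.g0 F ^ q) h2
    show _ ∈ B.J F ^ _
    convert h3 using 1
    rw [hq]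
    ring
  have h2 : ∀ y ∈ Ideal.span ((fun v => B.E F v ^ p) '' (B.W : Set _)), Tr p y ∈ B.I F := by
    intro y hy
    refine Submodule.span_induction (p := fun y _ => ∀ z, Tr p (z * y) ∈ B.I F) ?_ ?_ ?_ ?_ hy 1
      |> fun h => by simpa using h
    · rintro _ ⟨v, hv, rfl⟩ z
      have := Tr_minor_pow_mul (F := F) p (Fin.snoc B.rows v.1 : Fin (B.s+1) → Fin m)
        (Fin.snoc B.cols v.2 : Fin (B.s+1) → Fin n) 1 z
      rw [mul_one, pow_one] at this
      simp only
      rw [mul_comm z, Band.E, this]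
      exact Ideal.mul_mem_right _ _ (B.J_le_I F (Ideal.subset_span ⟨v, hv, rfl⟩))
    · intro z
      rw [mul_zero, Tr_zero p hp]
      exact zero_mem _
    · intro x y _ _ hx hy z
      rw [mul_add, Tr_add p hp]
      exact add_mem (hx z) (hy z)
    · intro a x _ hx z
      rw [smul_eq_mul, ← mul_assoc]
      exact hx _
  have h3 := h2 _ h1
  rw [Band.g0, Tr_minor_pow_mul] at h3
  exact B.nzd_pow F hD _ _ h3

end

end GBU

namespace GBU
open MvPolynomial

section
variable {F : Type*} [Field F] {m n : ℕ} (p : ℕ)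

/-- Stability under the Frobenius near-splitting. -/
def Stable (A : Ideal (MvPolynomial (Fin m × Fin n) F)) : Prop := ∀ h ∈ A, phi p h ∈ A

lemma Stable.sup (hp : 0 < p) {A B : Ideal (MvPolynomial (Fin m × Fin n) F)} (hA : Stable p A)
    (hB : Stable p B) : Stable p (A ⊔ B) := by
  intro h hh
  obtain ⟨a, ha, b, hb, rfl⟩ := Submodule.mem_sup.mp hh
  rw [phi_add p hp]
  exact Submodule.add_mem_sup (hA a ha) (hB b hb)

lemma degree_sup {ord : MonomialOrder (Fin m × Fin n)} (hD : Diag ord) (hp : 2 ≤ p)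
    {A B : Ideal (MvPolynomial (Fin m × Fin n) F)} (hA : Stable p A) (hB : Stable p B)
    (w : MvPolynomial (Fin m × Fin n) F) (hw : w ∈ A ⊔ B) (hw0 : w ≠ 0) :
    (∃ a ∈ A, a ≠ 0 ∧ ord.degree a = ord.degree w) ∨
    (∃ b ∈ B, b ≠ 0 ∧ ord.degree b = ord.degree w) := by
  obtain ⟨a, ha, b, hb, hab⟩ := Submodule.mem_sup.mp hw
  induction hx : ord.toSyn (ord.degree a) using
    (wellFounded_lt (α := ord.syn)).induction generalizing a b with
  | _ x ih =>
  by_cases ha0 : a = 0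
  · refine Or.inr ⟨b, hb, ?_⟩
    rw [ha0, zero_add] at hab
    rw [hab]; exact ⟨hw0, rfl⟩
  by_cases hb0 : b = 0
  · refine Or.inl ⟨a, ha, ?_⟩
    rw [hb0, add_zero] at hab
    rw [hab]; exact ⟨hw0, rfl⟩
  rcases lt_trichotomy (ord.toSyn (ord.degree b)) (ord.toSyn (ord.degree a)) with hlt | heq | hlt
  · refine Or.inl ⟨a, ha, ha0, ?_⟩
    rw [← hab, ord.degree_add_of_lt hlt]
  swap
  · refine Or.inr ⟨b, hb, hb0, ?_⟩
    rw [← hab, ord.degree_add_eq_right_of_lt hlt]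
  by_cases hu0 : ord.degree a = 0
  · refine Or.inl ⟨a, ha, ha0, ?_⟩
    apply ord.toSyn.injective
    have h1 : ord.toSyn (ord.degree w) ≤ ord.toSyn (ord.degree a) := by
      rw [← hab]
      refine ord.degree_add_le.trans ?_
      rw [heq, sup_idem]
    rw [hu0] at h1 ⊢
    exact le_antisymm (by rw [map_zero]; exact ord.zero_le _) h1
  have heq' := ord.toSyn.injective heq
  let y := monomial ((p - 2) • ord.degree a) (1 : F) * a * b
  have hm0 : monomial ((p - 2) • ord.degree a) (1 : F) ≠ 0 := by simp
  have hy0 : y ≠ 0 := mul_ne_zero (mul_ne_zero hm0 ha0) hb0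
  have hyd : ord.degree y = p • ord.degree a := by
    classical
    rw [ord.degree_mul (mul_ne_zero hm0 ha0) hb0, ord.degree_mul hm0 ha0, ord.degree_monomial,
      if_neg one_ne_zero, heq', ← succ_nsmul, ← succ_nsmul]
    congr 1; omega
  obtain ⟨hc0, hcd⟩ := phi_degree p hD (by omega) y hy0 _ hyd
  have hcA : phi p y ∈ A := hA _ (Ideal.mul_mem_right _ _ (Ideal.mul_mem_left _ _ ha))
  have hcB : phi p y ∈ B := hB _ (Ideal.mul_mem_left _ _ hb)
  have hu : IsUnit (ord.leadingCoeff (phi p y)) := by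
    rw [isUnit_iff_ne_zero]; exact ord.leadingCoeff_ne_zero_iff.mpr hc0
  have hlt := ord.degree_reduce_lt (f := a) hu (by rw [hcd]) hu0
  have hdiff : ∃ z, a - ord.reduce hu a = z * phi p y := by
    rw [MonomialOrder.reduce, sub_sub_cancel]
    exact ⟨_, rfl⟩
  obtain ⟨z, hz⟩ := hdiff
  refine ih _ (hx ▸ hlt) (ord.reduce hu a) ?_ (b + (a - ord.reduce hu a)) ?_ ?_ rfl
  · have : ord.reduce hu a = a - z * phi p y := by rw [← hz, sub_sub_cancel]
    rw [this]
    exact sub_mem ha (Ideal.mul_mem_left _ _ hcA)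
  · rw [hz]
    exact add_mem hb (Ideal.mul_mem_left _ _ hcB)
  · rw [← hab]; ring

lemma degree_finset_sup {ord : MonomialOrder (Fin m × Fin n)} (hD : Diag ord) (hp : 2 ≤ p)
    {ι : Type*} (A : ι → Ideal (MvPolynomial (Fin m × Fin n) F)) (hA : ∀ i, Stable p (A i))
    (S : Finset ι) : Stable p (S.sup A) ∧ ∀ w ∈ S.sup A, w ≠ 0 →
      ∃ i, ∃ a ∈ A i, a ≠ 0 ∧ ord.degree a = ord.degree w := by
  classical
  induction S using Finset.induction_on with
  | empty =>
    rw [Finset.sup_empty]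
    refine ⟨?_, ?_⟩
    · intro h hh
      rw [Ideal.mem_bot] at hh ⊢
      rw [hh, phi_zero p (by omega)]
    · intro w hw h0
      exact absurd (Ideal.mem_bot.mp hw) h0
  | insert i S hi ih =>
    rw [Finset.sup_insert]
    refine ⟨Stable.sup p (by omega) (hA i) ih.1, ?_⟩
    intro w hw h0
    rcases degree_sup p hD hp (hA i) ih.1 w hw h0 with ⟨a, h⟩ | ⟨b, hb, hb0, hbd⟩
    · exact ⟨i, a, h⟩
    · obtain ⟨i', a, h1, h2, h3⟩ := ih.2 b hb hb0
      exact ⟨i', a, h1, h2, h3.trans hbd⟩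

theorem charp_main {ord : MonomialOrder (Fin m × Fin n)} (hD : Diag ord) [Fact p.Prime] [CharP F p]
    {ι : Type*} [Fintype ι] (B : ι → Band m n) (w : MvPolynomial (Fin m × Fin n) F)
    (hw : w ∈ Finset.univ.sup fun i => (B i).I F) (h0 : w ≠ 0) :
    ∃ i, DiagDvd ((B i).s + 1) (B i).r1 (B i).r2 (B i).c1 (B i).c2 (ord.degree w) := by
  obtain ⟨i, a, ha, ha0, had⟩ := (degree_finset_sup p hD (Fact.out : p.Prime).two_le
    (fun i => (B i).I F) (fun i h hh => phi_mem p hD (B i) h hh) Finset.univ).2 w hw h0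
  refine ⟨i, ?_⟩
  rw [← had]
  exact diagDvd_degree hD _ _ _ _ _ a ha ha0

end
end GBU

namespace GBU
open MvPolynomial
section

variable {m n : ℕ} {ι : Type*} [Fintype ι] (B : ι → Band m n)

/-- The ideal of all the minors of the bands over a commutative ring. -/
noncomputable def NI (A : Type*) [CommRing A] : Ideal (MvPolynomial (Fin m × Fin n) A) :=
  Ideal.span { q | ∃ (i : ι) (r : Fin ((B i).s + 1) → Fin m) (c : Fin ((B i).s + 1) → Fin n),
    StrictMono r ∧ StrictMono c ∧
    (∀ j, (B i).r1 ≤ (r j).val + 1 ∧ (r j).val + 1 ≤ (B i).r2) ∧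
    (∀ j, (B i).c1 ≤ (c j).val + 1 ∧ (c j).val + 1 ≤ (B i).c2) ∧ q = minorP A r c }

lemma map_minorP {A A' : Type*} [CommRing A] [CommRing A'] (f : A →+* A') {t : ℕ}
    (r : Fin t → Fin m) (c : Fin t → Fin n) : map f (minorP A r c) = minorP A' r c := by
  rw [minorP, RingHom.map_det, minorP]
  congr 1
  ext1 i j
  simp

lemma sup_le_NI (K : Type*) [Field K] : (Finset.univ.sup fun i => (B i).I K) ≤ NI B K := by
  refine Finset.sup_le fun i _ => Ideal.span_le.mpr ?_
  rintro q ⟨r, c, hr, hc, h1, h2, rfl⟩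
  exact Ideal.subset_span ⟨i, r, c, hr, hc, h1, h2, rfl⟩

lemma NI_le_sup (K : Type*) [Field K] : NI B K ≤ (Finset.univ.sup fun i => (B i).I K) := by
  refine Ideal.span_le.mpr ?_
  rintro q ⟨i, r, c, hr, hc, h1, h2, rfl⟩
  exact Finset.le_sup (f := fun i => (B i).I K) (Finset.mem_univ i)
    (minorP_mem_aux K r c hr hc h1 h2)

lemma map_NI {A A' : Type*} [CommRing A] [CommRing A'] (f : A →+* A')
    (w : MvPolynomial (Fin m × Fin n) A) (hw : w ∈ NI B A) : map f w ∈ NI B A' := by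
  have : NI B A ≤ (NI B A').comap (map f) := by
    refine Ideal.span_le.mpr ?_
    rintro q ⟨i, r, c, hr, hc, h1, h2, rfl⟩
    exact Ideal.subset_span ⟨i, r, c, hr, hc, h1, h2, map_minorP f r c⟩
  exact this hw

lemma exists_descent {K : Type*} [Field K] (w : MvPolynomial (Fin m × Fin n) K)
    (hw : w ∈ NI B K) : ∃ T : Set K, T.Finite ∧ ∀ A : Subalgebra ℤ K, T ⊆ A →
      ∃ v ∈ NI B A, map (A.val : A →+* K) v = w := by
  induction hw using Submodule.span_induction with
  | mem q hq =>
    obtain ⟨i, r, c, hr, hc, h1, h2, rfl⟩ := hq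
    exact ⟨∅, Set.finite_empty, fun A _ => ⟨minorP A r c,
      Ideal.subset_span ⟨i, r, c, hr, hc, h1, h2, rfl⟩, map_minorP _ r c⟩⟩
  | zero => exact ⟨∅, Set.finite_empty, fun A _ => ⟨0, zero_mem _, map_zero _⟩⟩
  | add x y _ _ hx hy =>
    obtain ⟨T1, hT1, h1⟩ := hx
    obtain ⟨T2, hT2, h2⟩ := hy
    refine ⟨T1 ∪ T2, hT1.union hT2, fun A hA => ?_⟩
    obtain ⟨v1, hv1, e1⟩ := h1 A (Set.subset_union_left.trans hA)
    obtain ⟨v2, hv2, e2⟩ := h2 A (Set.subset_union_right.trans hA)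
    exact ⟨v1 + v2, add_mem hv1 hv2, by rw [map_add, e1, e2]⟩
  | smul a x _ hx =>
    obtain ⟨T1, hT1, h1⟩ := hx
    refine ⟨T1 ∪ (a.coeffs : Set K), hT1.union (Finset.finite_toSet _), fun A hA => ?_⟩
    obtain ⟨v1, hv1, e1⟩ := h1 A (Set.subset_union_left.trans hA)
    have ha : a ∈ Set.range (map (σ := Fin m × Fin n) (A.val : A →+* K)) := by
      rw [mem_range_map_iff_coeffs_subset]
      intro z hz
      exact ⟨⟨z, hA (Or.inr hz)⟩, rfl⟩
    obtain ⟨a', ha'⟩ := ha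
    exact ⟨a' * v1, Ideal.mul_mem_left _ _ hv1, by rw [map_mul, e1, ha', smul_eq_mul]⟩

lemma isJacobsonRing_int : IsJacobsonRing ℤ := by
  rw [isJacobsonRing_iff_prime_eq]
  intro P hP
  by_cases h : P = ⊥
  · subst h
    refine le_antisymm ?_ Ideal.le_jacobson
    intro x hx
    rw [Ideal.mem_jacobson_bot] at hx
    have h1 := Int.isUnit_iff.mp (hx (3 * x))
    rw [Ideal.mem_bot]
    rcases h1 with h1 | h1 <;> nlinarith [sq_nonneg x, h1]
  · have := hP.isMaximal h
    exact Ideal.jacobson_eq_self_of_isMaximal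

lemma exists_prime_char (F : Type*) [Field F] (hF : (Int.castRingHom F).FiniteType) :
    ∃ p : ℕ, p.Prime ∧ CharP F p := by
  obtain ⟨p, hp⟩ := CharP.exists F
  rcases CharP.char_is_prime_or_zero F p with h | rfl
  · exact ⟨p, h, hp⟩
  · exfalso
    have : CharZero F := CharP.charP_to_charZero F
    have := isJacobsonRing_int
    have hF' : Algebra.FiniteType ℤ F := by
      rw [← RingHom.finiteType_algebraMap]
      exact hF
    have := finite_of_finite_type_of_isJacobsonRing ℤ F
    have h := isField_of_isIntegral_of_isField (R := ℤ) (S := F)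
      (by simpa using (algebraMap ℤ F).injective_int) (Field.toIsField F)
    exact Int.not_isField h

theorem main {K : Type*} [Field K] {ord : MonomialOrder (Fin m × Fin n)} (hD : Diag ord)
    (w : MvPolynomial (Fin m × Fin n) K)
    (hw : w ∈ Finset.univ.sup fun i => (B i).I K) (h0 : w ≠ 0) :
    ∃ i, DiagDvd ((B i).s + 1) (B i).r1 (B i).r2 (B i).c1 (B i).c2 (ord.degree w) := by
  classical
  obtain ⟨T, hT, hTA⟩ := exists_descent B w (sup_le_NI B K hw)
  set T' : Set K := T ∪ {(ord.leadingCoeff w)⁻¹} with hT'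
  have hT'f : T'.Finite := hT.union (Set.finite_singleton _)
  let A : Subalgebra ℤ K := Algebra.adjoin ℤ T'
  have hfA : Algebra.FiniteType ℤ A := .adjoin_of_finite hT'f
  obtain ⟨v, hv, hvw⟩ := hTA A (Set.subset_union_left.trans Algebra.subset_adjoin)
  have hinvA : (ord.leadingCoeff w)⁻¹ ∈ A := Algebra.subset_adjoin (Or.inr rfl)
  obtain ⟨M, hM⟩ := Ideal.exists_maximal A
  let _ : Field (A ⧸ M) := Ideal.Quotient.field M
  have hfF : (Int.castRingHom (A ⧸ M)).FiniteType := by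
    have h1 : (Int.castRingHom A).FiniteType := by
      rw [RingHom.ext_int (Int.castRingHom A) (algebraMap ℤ A)]
      exact RingHom.finiteType_algebraMap.mpr hfA
    have h2 := RingHom.FiniteType.comp_surjective h1 (g := Ideal.Quotient.mk M)
      Ideal.Quotient.mk_surjective
    rwa [RingHom.ext_int ((Ideal.Quotient.mk M).comp (Int.castRingHom A)) (Int.castRingHom (A ⧸ M))] at h2
  obtain ⟨p, hp, hc⟩ := exists_prime_char (A ⧸ M) hfF
  haveI : Fact p.Prime := ⟨hp⟩
  set u := map (Ideal.Quotient.mk M) v with hu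
  have huN : u ∈ Finset.univ.sup fun i => (B i).I (A ⧸ M) := NI_le_sup B _ (map_NI B _ v hv)
  have hsupp : w.support = v.support := by
    rw [← hvw]
    exact support_map_of_injective v Subtype.val_injective
  have hcv : ((coeff (ord.degree w) v : A) : K) = ord.leadingCoeff w := by
    rw [MonomialOrder.leadingCoeff]
    conv_rhs => rw [← hvw]
    rw [coeff_map, hvw]
    rfl
  have hcu : coeff (ord.degree w) u ≠ 0 := by
    rw [hu, coeff_map]
    have : IsUnit (coeff (ord.degree w) v) := by
      refine IsUnit.of_mul_eq_one (⟨_, hinvA⟩ : A) (Subtype.ext ?_)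
      change ((coeff (ord.degree w) v : A) : K) * (ord.leadingCoeff w)⁻¹ = 1
      rw [hcv]
      exact mul_inv_cancel₀ (ord.leadingCoeff_ne_zero_iff.mpr h0)
    exact (this.map (Ideal.Quotient.mk M)).ne_zero
  have hu0 : u ≠ 0 := by
    intro h
    rw [h] at hcu
    exact hcu (coeff_zero _)
  have hdeg : ord.degree u = ord.degree w := by
    apply ord.toSyn.injective
    apply le_antisymm
    · rw [MonomialOrder.degree_le_iff]
      intro b hb
      apply ord.le_degree
      rw [hsupp]
      exact support_map_subset _ _ hb
    · exact ord.le_degree (mem_support_iff.mpr hcu)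
  rw [← hdeg]
  exact charp_main p hD B u huN hu0

end
end GBU

namespace GBU
open MvPolynomial

lemma exists_band {K : Type*} [Field K] {m n : ℕ} {t a b : ℕ} {cl : Bool}
    (hcol : cl = true → 1 ≤ a ∧ a ≤ b ∧ b ≤ n ∧ 1 ≤ t ∧ t ≤ b - a + 1 ∧ t ≤ m)
    (hrow : cl = false → 1 ≤ a ∧ a ≤ b ∧ b ≤ m ∧ 1 ≤ t ∧ t ≤ b - a + 1 ∧ t ≤ n)
    (I : Ideal (MvPolynomial (Fin m × Fin n) K))
    (hI : I = if cl then genMinors K m n t 1 m a b else genMinors K m n t a b 1 n) :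
    ∃ B : Band m n, I = B.I K := by
  cases cl with
  | true =>
    obtain ⟨h1, h2, h3, h4, h5, h6⟩ := hcol rfl
    obtain ⟨s, rfl⟩ := Nat.exists_eq_add_of_le' h4
    refine ⟨⟨s, 1, m, a, b, le_rfl, by omega, le_rfl, h1, by omega, h3, Or.inl ⟨rfl, rfl⟩⟩, ?_⟩
    rw [hI, if_pos rfl]
    rfl
  | false =>
    obtain ⟨h1, h2, h3, h4, h5, h6⟩ := hrow rfl
    obtain ⟨s, rfl⟩ := Nat.exists_eq_add_of_le' h4
    refine ⟨⟨s, a, b, 1, n, h1, by omega, h3, le_rfl, by omega, le_rfl, Or.inr ⟨rfl, rfl⟩⟩, ?_⟩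
    rw [hI, if_neg Bool.false_ne_true]
    rfl

lemma initialIdeal_mono {σ K : Type*} [Field K] (ord : MonomialOrder σ)
    {J J' : Ideal (MvPolynomial σ K)} (h : J ≤ J') : initialIdeal ord J ≤ initialIdeal ord J' :=
  Ideal.span_mono fun _ ⟨p, hp, hp0, hq⟩ => ⟨p, h hp, hp0, hq⟩

lemma monomial_mem_initialIdeal {K : Type*} [Field K] {m n : ℕ}
    {ord : MonomialOrder (Fin m × Fin n)} (hD : Diag ord) (B : Band m n)
    (u : (Fin m × Fin n) →₀ ℕ) (h : DiagDvd (B.s + 1) B.r1 B.r2 B.c1 B.c2 u) :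
    monomial u (1 : K) ∈ initialIdeal ord (B.I K) := by
  obtain ⟨r, c, hr, hc, h1, h2, h3⟩ := diagDvd_iff.mp h
  have : monomial u (1 : K) = monomial (u - dexp r c 1) 1 * monomial (dexp r c 1) 1 := by
    rw [monomial_mul, mul_one, tsub_add_cancel_of_le h3]
  rw [this]
  refine Ideal.mul_mem_left _ _ (Ideal.subset_span ⟨minorP K r c,
    minorP_mem_aux K r c hr hc h1 h2, ?_, ?_⟩)
  · exact (monic_minorP K hD hr hc).ne_zero
  · rw [← degree_minorP K hD hr hc]
    rfl

lemma initialIdeal_sum {K : Type*} [Field K] {m n k : ℕ}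
    {ord : MonomialOrder (Fin m × Fin n)} (hD : Diag ord) (B : Fin k → Band m n) :
    initialIdeal ord (∑ i, (B i).I K) = ∑ i, initialIdeal ord ((B i).I K) := by
  rw [Ideal.sum_eq_sup, Ideal.sum_eq_sup]
  apply le_antisymm
  · refine Ideal.span_le.mpr ?_
    rintro q ⟨p, hp, hp0, rfl⟩
    obtain ⟨i, hi⟩ := main B hD p hp hp0
    exact Finset.le_sup (f := fun i => initialIdeal ord ((B i).I K)) (Finset.mem_univ i)
      (monomial_mem_initialIdeal hD (B i) _ hi)
  · exact Finset.sup_le fun i hi => initialIdeal_mono ord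
      (Finset.le_sup (f := fun i => (B i).I K) hi)

lemma groebner_union {σ K : Type*} [Field K] (ord : MonomialOrder σ) {k : ℕ}
    (I : Fin k → Ideal (MvPolynomial σ K)) (G : Fin k → Set (MvPolynomial σ K))
    (hG : ∀ i, IsGroebnerBasis ord (G i) (I i))
    (h : initialIdeal ord (∑ i, I i) = ∑ i, initialIdeal ord (I i)) :
    IsGroebnerBasis ord (⋃ i, G i) (∑ i, I i) := by
  refine ⟨Set.finite_iUnion fun i => (hG i).1, Set.iUnion_subset fun i x hx => ?_, ?_⟩
  · rw [Ideal.sum_eq_sup]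
    exact Finset.le_sup (f := I) (Finset.mem_univ i) ((hG i).2.1 hx)
  · rw [h, Ideal.sum_eq_sup, Finset.sup_univ_eq_iSup]
    simp_rw [← fun i => (hG i).2.2]
    rw [← Ideal.span_iUnion]
    congr 1
    ext q
    simp only [Set.mem_setOf_eq, Set.mem_iUnion]
    constructor
    · rintro ⟨p, ⟨i, hi⟩, h⟩
      exact ⟨i, p, hi, h⟩
    · rintro ⟨i, p, hi, h⟩
      exact ⟨p, ⟨i, hi⟩, h⟩

end GBU


/-- Let `≺` be a diagonal monomial order and `I = I₁ + … + I_k`, where each `Iᵢ` is an ideal of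
`tᵢ`-minors on consecutive columns (`cl i = true`) or consecutive rows (`cl i = false`) of the
generic matrix.  If `Gᵢ` is a Gröbner basis of `Iᵢ` for each `i`, then `G₁ ∪ … ∪ G_k` is a
Gröbner basis of `I`; equivalently, the initial ideal of `I` is the sum of the initial ideals
of the `Iᵢ`. -/
theorem groebner_basis_union_sum_minors (K : Type*) [Field K] (m n : ℕ)
    (hm : 0 < m) (hmn : m < n) (ord : MonomialOrder (Fin m × Fin n))
    (hdiag : IsDiagonalOrder K m n ord)
    (k : ℕ) (t a b : Fin k → ℕ) (cl : Fin k → Bool)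
    (hcol : ∀ i, cl i = true →
      1 ≤ a i ∧ a i ≤ b i ∧ b i ≤ n ∧ 1 ≤ t i ∧ t i ≤ b i - a i + 1 ∧ t i ≤ m)
    (hrow : ∀ i, cl i = false →
      1 ≤ a i ∧ a i ≤ b i ∧ b i ≤ m ∧ 1 ≤ t i ∧ t i ≤ b i - a i + 1 ∧ t i ≤ n)
    (I : Fin k → Ideal (MvPolynomial (Fin m × Fin n) K))
    (hI : ∀ i, I i = if cl i then genMinors K m n (t i) 1 m (a i) (b i)
                     else genMinors K m n (t i) (a i) (b i) 1 n)
    (G : Fin k → Set (MvPolynomial (Fin m × Fin n) K))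
    (hG : ∀ i, IsGroebnerBasis ord (G i) (I i)) :
    IsGroebnerBasis ord (⋃ i, G i) (∑ i, I i) ∧
      initialIdeal ord (∑ i, I i) = ∑ i, initialIdeal ord (I i) := by
  have hD := GBU.diag_of_isDiagonalOrder hdiag
  choose B hB using fun i => GBU.exists_band (K := K) (m := m) (n := n) (hcol i) (hrow i) (I i) (hI i)
  have h : initialIdeal ord (∑ i, I i) = ∑ i, initialIdeal ord (I i) := by
    obtain rfl : I = fun i => (B i).I K := funext hB
    exact GBU.initialIdeal_sum hD B
  exact ⟨GBU.groebner_union ord I G hG h, h⟩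
end
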